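/- Let S be a multiplicative set of positive integers satisfying Condition B with density δ ∈ (0,1) and exponent ρ > 0, let C_0(S) be the Wirsing constant and γ_S the Euler–Kronecker constant of S. If γ_S < 1/2, then for all sufficiently large x one has |S(x) − C_0(S)·∫₂^x (log t)^{δ−1} dt| < |S(x) − C_0(S)·x·(log x)^{δ−1}| (the Ramanujan approximation is asymptotically better than the Landau approximation); if γ_S > 1/2, then for all sufficiently large x the reverse strict inequality holds (the Landau approximation is better). -/

import Mathlib

open Filter Real
open scoped Classical

/-- A set of positive integers is *multiplicative* if `1 ∈ S` and for all coprime
positive integers `m, n` one has `m * n ∈ S ↔ m ∈ S ∧ n ∈ S`. -/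
def IsMultiplicativeSet (S : Set ℕ) : Prop :=
  1 ∈ S ∧ ∀ m n : ℕ, 0 < m → 0 < n → Nat.Coprime m n → (m * n ∈ S ↔ m ∈ S ∧ n ∈ S)

/-- `S(x)`: the number of `n ≤ x` with `n ∈ S`. -/
noncomputable def setCount (S : Set ℕ) (x : ℝ) : ℕ :=
  {n : ℕ | 0 < n ∧ (n : ℝ) ≤ x ∧ n ∈ S}.ncard

/-- `π_S(x)`: the number of primes `p ≤ x` with `p ∈ S`. -/
noncomputable def primeCount (S : Set ℕ) (x : ℝ) : ℕ :=
  {p : ℕ | p.Prime ∧ (p : ℝ) ≤ x ∧ p ∈ S}.ncard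

/-- The characteristic function of `S`. -/
noncomputable def chiS (S : Set ℕ) (n : ℕ) : ℝ := if n ∈ S then 1 else 0

/-- The logarithmic integral `Li(x) = ∫₂ˣ dt / log t`. -/
noncomputable def Li (x : ℝ) : ℝ := ∫ t in (2:ℝ)..x, 1 / Real.log t

/-- Condition B with density `δ` and exponent `ρ`:
`π_S(x) = δ Li(x) + O(x / (log x)^{2+ρ})`. -/
def ConditionB (S : Set ℕ) (δ ρ : ℝ) : Prop :=
  ∃ C : ℝ, ∀ x : ℝ, 2 ≤ x →
    |(primeCount S x : ℝ) - δ * Li x| ≤ C * x / Real.log x ^ (2 + ρ)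

/-- The Dirichlet series `L_S(s) = ∑_{n ∈ S} n^{-s}` of `S` (as a function of a real
variable `s`). -/
noncomputable def LSeries' (S : Set ℕ) (s : ℝ) : ℝ :=
  ∑' n : ℕ, if n ∈ S then (n : ℝ) ^ (-s) else 0

/-- `γS` is the Euler–Kronecker constant of `S` (with density `δ`), i.e.
`L_S'(s)/L_S(s) + δ/(s-1) → γS` as `s → 1⁺`. -/
def IsEulerKronecker (S : Set ℕ) (δ γS : ℝ) : Prop :=
  Tendsto (fun s : ℝ => deriv (LSeries' S) s / LSeries' S s + δ / (s - 1))
    (nhdsWithin 1 (Set.Ioi 1)) (nhds γS)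

/-- The partial Euler-type product
`∏_{p < P, p prime} (1 + χ_S(p)/p + χ_S(p²)/p² + …) (1 - 1/p)^δ`. -/
noncomputable def wirsingProd (S : Set ℕ) (δ : ℝ) (P : ℕ) : ℝ :=
  ∏ p ∈ Finset.filter Nat.Prime (Finset.range P),
    (∑' e : ℕ, chiS S (p ^ e) / (p : ℝ) ^ e) * (1 - 1 / (p : ℝ)) ^ δ

/-- The summatory function of `f` over positive integers. -/
noncomputable def sumUpTo (f : ℕ → ℝ) (x : ℝ) : ℝ := ∑ m ∈ Finset.Ioc 0 ⌊x⌋₊, f m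

/-- The integral `∫₁^{eᵘ} F(t) t⁻² dt` of the summatory function `F` of `f`, as a finite sum. -/
noncomputable def meanSum (f : ℕ → ℝ) (u : ℝ) : ℝ :=
  ∑ m ∈ Finset.Ioc 0 ⌊exp u⌋₊, f m * (1 / m - exp (-u))

lemma eventually_floor_exp_eq (u : ℝ) : ∀ᶠ v in nhdsWithin u (Set.Ici u), ⌊exp v⌋₊ = ⌊exp u⌋₊ := by
  have h1 : ∀ᶠ v in nhdsWithin u (Set.Ici u), exp v < ⌊exp u⌋₊ + 1 := by
    have : ContinuousAt exp u := continuous_exp.continuousAt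
    exact (this.eventually (gt_mem_nhds (Nat.lt_floor_add_one (exp u)))).filter_mono
      nhdsWithin_le_nhds
  filter_upwards [h1, self_mem_nhdsWithin] with v hv huv
  refine (Nat.floor_eq_iff (exp_pos v).le).2 ⟨?_, hv⟩
  exact (Nat.floor_le (exp_pos u).le).trans (exp_le_exp.2 huv)

lemma meanSum_hasDerivWithinAt (f : ℕ → ℝ) (u : ℝ) :
    HasDerivWithinAt (meanSum f) (sumUpTo f (exp u) * exp (-u)) (Set.Ici u) u := by
  have h : HasDerivAt (fun v : ℝ => ∑ m ∈ Finset.Ioc 0 ⌊exp u⌋₊, f m * (1 / m - exp (-v)))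
      (∑ m ∈ Finset.Ioc 0 ⌊exp u⌋₊, f m * exp (-u)) u := by
    apply HasDerivAt.fun_sum
    intro m _
    have h2 : HasDerivAt (fun v : ℝ => exp (-v)) (-exp (-u)) u := by
      simpa using (hasDerivAt_neg u).exp
    simpa using (h2.const_sub (1 / (m : ℝ))).const_mul (f m)
  rw [sumUpTo, Finset.sum_mul]
  refine h.hasDerivWithinAt.congr_of_eventuallyEq ?_ rfl
  filter_upwards [eventually_floor_exp_eq u] with v hv
  simp [meanSum, hv]

lemma meanSum_eq_sum_max (f : ℕ → ℝ) {u : ℝ} {N : ℕ} (h : exp u ≤ N) :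
    meanSum f u = ∑ m ∈ Finset.Ioc 0 N, f m * max 0 (1 / m - exp (-u)) := by
  have hsub : Finset.Ioc 0 ⌊exp u⌋₊ ⊆ Finset.Ioc 0 N :=
    Finset.Ioc_subset_Ioc_right (Nat.floor_le_of_le h)
  rw [meanSum, ← Finset.sum_subset hsub]
  · refine Finset.sum_congr rfl fun m hm => ?_
    obtain ⟨hm0, hm1⟩ := Finset.mem_Ioc.1 hm
    rw [max_eq_right]
    have hm2 : (m : ℝ) ≤ exp u := (Nat.le_floor_iff (exp_pos u).le).1 hm1
    rw [exp_neg, ← one_div, sub_nonneg]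
    exact one_div_le_one_div_of_le (by exact_mod_cast hm0) hm2
  · intro m hm hm'
    have hm0 : 0 < m := (Finset.mem_Ioc.1 hm).1
    have hm2 : exp u < m := by
      by_contra hc
      exact hm' (Finset.mem_Ioc.2 ⟨hm0, (Nat.le_floor_iff (exp_pos u).le).2 (not_lt.1 hc)⟩)
    rw [max_eq_left, mul_zero]
    rw [exp_neg, ← one_div, sub_nonpos]
    exact one_div_le_one_div_of_le (exp_pos u) hm2.le

lemma continuous_meanSum (f : ℕ → ℝ) : Continuous (meanSum f) := by
  rw [continuous_iff_continuousAt]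
  intro u
  obtain ⟨N, hN⟩ := exists_nat_gt (exp u)
  have h : meanSum f =ᶠ[nhds u]
      fun v => ∑ m ∈ Finset.Ioc 0 N, f m * max 0 (1 / m - exp (-v)) := by
    filter_upwards [continuous_exp.continuousAt.eventually (gt_mem_nhds hN)] with v hv
    exact meanSum_eq_sum_max f hv.le
  refine ContinuousAt.congr ?_ h.symm
  fun_prop

/-- A function with right derivative bounded by `M / u ^ 2` varies little at infinity. -/
lemma abs_sub_le_of_deriv_right_le {P p : ℝ → ℝ} {u₀ M : ℝ} (hu₀ : 0 < u₀)
    (hc : ContinuousOn P (Set.Ici u₀))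
    (hd : ∀ u, u₀ ≤ u → HasDerivWithinAt P (p u) (Set.Ici u) u)
    (hp : ∀ u, u₀ ≤ u → |p u| ≤ M / u ^ 2) {w : ℝ} (hw : u₀ ≤ w) {u : ℝ} (hu : w ≤ u) :
    |P u - P w| ≤ M * (1 / w - 1 / u) := by
  have hw0 : 0 < w := hu₀.trans_le hw
  have key := image_norm_le_of_norm_deriv_right_le_deriv_boundary' (a := w) (b := u)
    (f := fun v => P v - P w) (f' := p) (B := fun v => M * (1 / w - 1 / v))
    (B' := fun v => M / v ^ 2) ?_ ?_ ?_ ?_ ?_ ?_ (Set.right_mem_Icc.2 hu)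
  · simpa using key
  · refine (hc.mono ?_).sub continuousOn_const
    exact fun v hv => hw.trans hv.1
  · intro v hv
    exact (hd v (hw.trans hv.1)).sub_const _
  · simp
  · intro v hv
    have : v ≠ 0 := (hw0.trans_le hv.1).ne'
    apply ContinuousAt.continuousWithinAt
    fun_prop (disch := assumption)
  · intro v hv
    have hv0 : v ≠ 0 := (hw0.trans_le hv.1).ne'
    have := (((hasDerivAt_inv hv0).const_sub (1 / w)).const_mul M).hasDerivWithinAt (s := Set.Ici v)
    simp only [one_div] at this ⊢
    exact this.congr_deriv (by field_simp)
  · intro v hv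
    exact hp v (hw.trans hv.1)

/-- If the right derivative of `P` is `O(1 / u ^ 2)` then `P` converges at infinity. -/
lemma exists_tendsto_of_deriv_right_le {P p : ℝ → ℝ} {u₀ M : ℝ} (hu₀ : 0 < u₀)
    (hc : ContinuousOn P (Set.Ici u₀))
    (hd : ∀ u, u₀ ≤ u → HasDerivWithinAt P (p u) (Set.Ici u) u)
    (hp : ∀ u, u₀ ≤ u → |p u| ≤ M / u ^ 2) :
    ∃ A, Tendsto P atTop (nhds A) := by
  have hM : 0 ≤ M := by
    have := (abs_nonneg _).trans (hp u₀ le_rfl)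
    by_contra hneg
    have h2 : M / u₀ ^ 2 < 0 := div_neg_of_neg_of_pos (not_le.1 hneg) (by positivity)
    linarith
  apply cauchy_map_iff_exists_tendsto.1
  rw [Metric.cauchy_iff]
  refine ⟨inferInstance, fun ε hε => ?_⟩
  refine ⟨P '' Set.Ici (max u₀ (3 * (M + 1) / ε)), image_mem_map (Ici_mem_atTop _), ?_⟩
  set w := max u₀ (3 * (M + 1) / ε) with hw
  have hw0 : 0 < w := hu₀.trans_le (le_max_left _ _)
  have hbd : ∀ u, w ≤ u → |P u - P w| ≤ ε / 3 := by
    intro u hu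
    have h1 := abs_sub_le_of_deriv_right_le hu₀ hc hd hp (le_max_left u₀ (3 * (M + 1) / ε)) hu
    refine h1.trans ?_
    have h2 : 3 * (M + 1) / ε ≤ w := le_max_right _ _
    have h3 : M * (1 / w) ≤ ε / 3 := by
      rw [div_le_iff₀ hε] at h2
      rw [mul_one_div, div_le_iff₀ hw0]
      linarith
    have h4 : 0 ≤ M * (1 / u) := by
      have : 0 < u := hw0.trans_le hu
      positivity
    linarith
  rintro _ ⟨x, hx, rfl⟩ _ ⟨y, hy, rfl⟩
  rw [Real.dist_eq]
  have h1 := hbd x hx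
  have h2 := hbd y hy
  rw [abs_le] at h1 h2
  rw [abs_lt]
  constructor <;> linarith [h1.1, h1.2, h2.1, h2.2]

/-- If the right derivative of `P` is `(K + o(1)) / u ^ 2`, then `P` is `A - (K + o(1)) / u`. -/
lemma tendsto_mul_sub_of_deriv_right {P p : ℝ → ℝ} {u₀ K A : ℝ} (hu₀ : 0 < u₀)
    (hc : ContinuousOn P (Set.Ici u₀))
    (hd : ∀ u, u₀ ≤ u → HasDerivWithinAt P (p u) (Set.Ici u) u)
    (hp : Tendsto (fun u => u ^ 2 * p u) atTop (nhds K)) (hA : Tendsto P atTop (nhds A)) :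
    Tendsto (fun u => u * (P u - A)) atTop (nhds (-K)) := by
  rw [Metric.tendsto_atTop] at hp ⊢
  intro ε hε
  obtain ⟨N, hN⟩ := hp (ε / 2) (by positivity)
  refine ⟨max u₀ N, fun w hw => ?_⟩
  have hw0 : 0 < w := hu₀.trans_le ((le_max_left _ _).trans hw)
  set u₁ := max u₀ N with hu₁
  have hu₁0 : 0 < u₁ := hu₀.trans_le (le_max_left _ _)
  have hd2 : ∀ u, u₁ ≤ u →
      HasDerivWithinAt (fun v => P v + K / v) (p u - K / u ^ 2) (Set.Ici u) u := by
    intro u hu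
    have hu0 : u ≠ 0 := (hu₁0.trans_le hu).ne'
    have h1 := (hd u ((le_max_left _ _).trans hu))
    have h2 := ((hasDerivAt_inv hu0).const_mul K).hasDerivWithinAt (s := Set.Ici u)
    exact (h1.fun_add h2).congr_deriv (by field_simp; ring)
  have hb2 : ∀ u, u₁ ≤ u → |p u - K / u ^ 2| ≤ (ε / 2) / u ^ 2 := by
    intro u hu
    have hu0 : 0 < u := (hu₁0.trans_le hu)
    have := (hN u ((le_max_right _ _).trans hu)).le
    rw [Real.dist_eq] at this
    have heq : p u - K / u ^ 2 = (u ^ 2 * p u - K) / u ^ 2 := by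
      field_simp
    rw [heq, abs_div, abs_of_pos (show 0 < u ^ 2 by positivity)]
    gcongr
  have hc2 : ContinuousOn (fun v => P v + K / v) (Set.Ici u₁) := by
    refine (hc.mono (Set.Ici_subset_Ici.2 (le_max_left _ _))).add ?_
    refine continuousOn_const.div continuousOn_id ?_
    intro v hv
    exact (hu₁0.trans_le hv).ne'
  have key : ∀ u, w ≤ u → |(P u + K / u) - (P w + K / w)| ≤ (ε / 2) * (1 / w - 1 / u) :=
    fun u hu => abs_sub_le_of_deriv_right_le hu₁0 hc2 hd2 hb2 hw hu
  have hinv : Tendsto (fun u : ℝ => 1 / u) atTop (nhds 0) := by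
    simpa using tendsto_inv_atTop_zero (𝕜 := ℝ)
  have hinvK : Tendsto (fun u : ℝ => K / u) atTop (nhds 0) :=
    tendsto_const_nhds.div_atTop tendsto_id
  have lim1 : Tendsto (fun u => |(P u + K / u) - (P w + K / w)|) atTop
      (nhds |(A + 0) - (P w + K / w)|) := ((hA.add hinvK).sub_const _).abs
  have lim2 : Tendsto (fun u => (ε / 2) * (1 / w - 1 / u)) atTop
      (nhds ((ε / 2) * (1 / w - 0))) := (hinv.const_sub _).const_mul _
  have hle := le_of_tendsto_of_tendsto lim1 lim2 (eventually_atTop.2 ⟨w, key⟩)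
  rw [Real.dist_eq]
  have : w * (P w - A) - -K = -(w * ((A + 0) - (P w + K / w))) := by
    field_simp
    ring
  rw [this, abs_neg, abs_mul, abs_of_pos hw0]
  calc w * |(A + 0) - (P w + K / w)| ≤ w * ((ε / 2) * (1 / w - 0)) := by gcongr
    _ = ε / 2 := by field_simp; ring
    _ < ε := by linarith

lemma summable_one_add_rpow_neg {ρ : ℝ} (hρ : 0 < ρ) :
    Summable fun j : ℕ => (1 + (j : ℝ)) ^ (-(1 + ρ)) := by
  have h := (summable_nat_add_iff 1).2 (Real.summable_nat_rpow.2 (show -(1 + ρ) < -1 by linarith))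
  refine h.congr fun j => ?_
  push_cast
  rw [add_comm]

lemma mem_Ioc_floor_iff {x : ℝ} (hx : 0 ≤ x) {m : ℕ} :
    m ∈ Finset.Ioc 0 ⌊x⌋₊ ↔ 0 < m ∧ (m : ℝ) ≤ x := by
  rw [Finset.mem_Ioc, Nat.le_floor_iff hx]

/-- Bound for the weighted sum `∑ f m (x / m) (1 + log (x / m)) ^ (-1 - ρ)` over `m ≤ x e^{-j₀}`. -/
lemma weighted_tail_le {f : ℕ → ℝ} {δ ρ C₁ C₂ : ℝ} (hf : ∀ m, 0 ≤ f m) (hδ1 : δ < 1) (hρ : 0 < ρ)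
    (hC₁ : 0 ≤ C₁)
    (h₁ : ∀ x, 1 ≤ x → sumUpTo f x ≤ C₁ * x * (1 + log x) ^ (δ - 1))
    (h₂ : ∀ x, 1 ≤ x → sumUpTo (fun m => f m / m) x ≤ C₂ * (1 + log x) ^ δ)
    {x : ℝ} (hx : 1 ≤ x) (j₀ : ℕ) :
    ∑ m ∈ Finset.Ioc 0 ⌊x⌋₊ with (j₀ : ℝ) ≤ log (x / (m : ℕ)),
        f m * ((x / m) * (1 + log (x / m)) ^ (-(1 + ρ))) ≤
      (exp 1 * C₁ * 2 ^ (1 - δ) + C₂ * 2 ^ (1 + ρ)) * (x * (1 + log x) ^ (δ - 1) *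
        (∑' j : ℕ, (1 + ((j + j₀ : ℕ) : ℝ)) ^ (-(1 + ρ)) + (1 + log x) ^ (-ρ))) := by
  have hx0 : 0 < x := by linarith
  set L := log x with hL
  have hL0 : 0 ≤ L := log_nonneg hx
  set a : ℕ → ℝ := fun j => (1 + (j : ℝ)) ^ (-(1 + ρ)) with ha
  have ha0 : ∀ j, 0 ≤ a j := fun j => by positivity
  have hsa : Summable a := summable_one_add_rpow_neg hρ
  set A := ∑' j : ℕ, a (j + j₀) with hA
  have hA0 : 0 ≤ A := tsum_nonneg fun j => ha0 _
  set s := Finset.Ioc 0 ⌊x⌋₊ with hs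
  have hms : ∀ m ∈ s, 0 < (m : ℝ) ∧ (m : ℝ) ≤ x := fun m hm => by
    have := (mem_Ioc_floor_iff hx0.le).1 hm
    exact ⟨by exact_mod_cast this.1, this.2⟩
  have hlog : ∀ m ∈ s, 0 ≤ log (x / m) := fun m hm =>
    log_nonneg ((one_le_div (hms m hm).1).2 (hms m hm).2)
  set t : ℕ → ℝ := fun m => f m * ((x / m) * (1 + log (x / m)) ^ (-(1 + ρ))) with ht
  have ht0 : ∀ m ∈ s, 0 ≤ t m := fun m hm => by
    have := hms m hm
    have := hlog m hm
    have := hf m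
    positivity
  -- the part `m ≤ √x`
  have hC₂ : 0 ≤ C₂ := by
    have := (h₂ 1 le_rfl)
    simp only [log_one, add_zero, one_rpow, mul_one] at this
    refine le_trans ?_ this
    exact Finset.sum_nonneg fun m _ => div_nonneg (hf m) (Nat.cast_nonneg _)
  have part1 : ∑ m ∈ s with L / 2 ≤ log (x / (m : ℕ)), t m ≤
      C₂ * 2 ^ (1 + ρ) * (x * (1 + L) ^ (δ - 1) * (1 + L) ^ (-ρ)) := by
    calc ∑ m ∈ s with L / 2 ≤ log (x / (m : ℕ)), t m
        ≤ ∑ m ∈ s with L / 2 ≤ log (x / (m : ℕ)), (f m / m) *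
            (x * (2 ^ (1 + ρ) * (1 + L) ^ (-(1 + ρ)))) := by
          refine Finset.sum_le_sum fun m hm => ?_
          obtain ⟨hm, hm'⟩ := Finset.mem_filter.1 hm
          have h1 : (1 + log (x / m)) ^ (-(1 + ρ)) ≤ 2 ^ (1 + ρ) * (1 + L) ^ (-(1 + ρ)) := by
            have h2 : (1 + log (x / m)) ^ (-(1 + ρ)) ≤ ((1 + L) / 2) ^ (-(1 + ρ)) :=
              rpow_le_rpow_of_nonpos (by positivity) (by linarith) (by linarith)
            rw [div_rpow (by positivity) (by norm_num), rpow_neg (show (0:ℝ) ≤ 2 by norm_num)] at h2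
            refine h2.trans_eq ?_
            field_simp
          have h3 := (hms m hm).1
          have : t m = (f m / m) * (x * (1 + log (x / m)) ^ (-(1 + ρ))) := by
            rw [ht]; field_simp
          rw [this]
          have := hf m
          gcongr
      _ ≤ ∑ m ∈ s, (f m / m) * (x * (2 ^ (1 + ρ) * (1 + L) ^ (-(1 + ρ)))) := by
          refine Finset.sum_le_sum_of_subset_of_nonneg (Finset.filter_subset _ _) fun m _ _ => ?_
          have := hf m
          positivity
      _ = sumUpTo (fun m => f m / m) x * (x * (2 ^ (1 + ρ) * (1 + L) ^ (-(1 + ρ)))) := by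
          rw [sumUpTo, Finset.sum_mul]
      _ ≤ C₂ * (1 + L) ^ δ * (x * (2 ^ (1 + ρ) * (1 + L) ^ (-(1 + ρ)))) := by
          gcongr
          exact h₂ x hx
      _ = C₂ * 2 ^ (1 + ρ) * (x * ((1 + L) ^ δ * (1 + L) ^ (-(1 + ρ)))) := by ring
      _ = C₂ * 2 ^ (1 + ρ) * (x * (1 + L) ^ (δ - 1) * (1 + L) ^ (-ρ)) := by
          rw [← rpow_add (by positivity), mul_assoc x, ← rpow_add (by positivity)]
          ring_nf
  -- the part `m > √x`, in blocks
  have part2 : ∑ m ∈ s with ((j₀ : ℝ) ≤ log (x / (m : ℕ)) ∧ log (x / m) < L / 2), t m ≤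
      exp 1 * C₁ * 2 ^ (1 - δ) * (x * (1 + L) ^ (δ - 1) * A) := by
    set s' := s.filter fun m : ℕ => ((j₀ : ℝ) ≤ log (x / m) ∧ log (x / m) < L / 2) with hs'
    have hs's : ∀ m ∈ s', m ∈ s := fun m hm => (Finset.mem_filter.1 hm).1
    have hmaps : ∀ m ∈ s', ⌊log (x / m)⌋₊ ∈ Finset.Ico j₀ (⌊L / 2⌋₊ + 1) := by
      intro m hm
      obtain ⟨hm1, hm2, hm3⟩ := Finset.mem_filter.1 hm
      rw [Finset.mem_Ico]
      exact ⟨Nat.le_floor hm2, Nat.lt_succ_of_le (Nat.floor_le_floor hm3.le)⟩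
    rw [← Finset.sum_fiberwise_of_maps_to hmaps]
    have hblock : ∀ j ∈ Finset.Ico j₀ (⌊L / 2⌋₊ + 1),
        ∑ m ∈ s' with ⌊log (x / (m : ℕ))⌋₊ = j, t m ≤
          a j * (exp 1 * C₁ * 2 ^ (1 - δ) * (x * (1 + L) ^ (δ - 1))) := by
      intro j hj
      have hjL : (j : ℝ) ≤ L / 2 := by
        rw [Finset.mem_Ico] at hj
        exact (Nat.le_floor_iff (by positivity)).1 (Nat.le_of_lt_succ hj.2)
      set y := x * exp (-j) with hy
      have hy0 : 0 < y := by positivity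
      have hylog : log y = L - j := by
        rw [hy, log_mul hx0.ne' (exp_pos _).ne', log_exp]; ring
      have hy1 : 1 ≤ y := by
        rw [← log_nonneg_iff hy0, hylog]; linarith
      calc ∑ m ∈ s' with ⌊log (x / (m : ℕ))⌋₊ = j, t m
          ≤ ∑ m ∈ s' with ⌊log (x / (m : ℕ))⌋₊ = j, f m * (exp (j + 1) * a j) := by
            refine Finset.sum_le_sum fun m hm => ?_
            obtain ⟨hm, hmj⟩ := Finset.mem_filter.1 hm
            have hm' := hs's m hm
            have hl := hlog m hm'
            have hm0 := (hms m hm').1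
            rw [Nat.floor_eq_iff hl] at hmj
            have h1 : x / m ≤ exp (j + 1) := by
              rw [← exp_log (show 0 < x / m by positivity)]
              exact exp_le_exp.2 hmj.2.le
            have h2 : (1 + log (x / m)) ^ (-(1 + ρ)) ≤ a j :=
              rpow_le_rpow_of_nonpos (by positivity) (by linarith [hmj.1]) (by linarith)
            have := hf m
            simp only [ht]
            gcongr
        _ ≤ ∑ m ∈ Finset.Ioc 0 ⌊y⌋₊, f m * (exp (j + 1) * a j) := by
            refine Finset.sum_le_sum_of_subset_of_nonneg ?_ fun m _ _ => ?_
            · intro m hm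
              obtain ⟨hm, hmj⟩ := Finset.mem_filter.1 hm
              have hm' := hs's m hm
              have hl := hlog m hm'
              have hm0 := (hms m hm').1
              rw [Nat.floor_eq_iff hl] at hmj
              rw [mem_Ioc_floor_iff hy0.le]
              refine ⟨by exact_mod_cast hm0, ?_⟩
              have h1 : exp j ≤ x / m := by
                rw [← exp_log (show 0 < x / m by positivity)]
                exact exp_le_exp.2 hmj.1
              rw [le_div_iff₀ hm0] at h1
              rw [hy, exp_neg, ← div_eq_mul_inv, le_div_iff₀ (exp_pos _)]
              linarith
            · have := hf m
              have := ha0 j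
              positivity
        _ = sumUpTo f y * (exp (j + 1) * a j) := by rw [sumUpTo, Finset.sum_mul]
        _ ≤ C₁ * y * (1 + log y) ^ (δ - 1) * (exp (j + 1) * a j) := by
            have := ha0 j
            gcongr
            exact h₁ y hy1
        _ ≤ C₁ * y * (2 ^ (1 - δ) * (1 + L) ^ (δ - 1)) * (exp (j + 1) * a j) := by
            have := ha0 j
            gcongr
            have h2 : (1 + log y) ^ (δ - 1) ≤ ((1 + L) / 2) ^ (δ - 1) :=
              rpow_le_rpow_of_nonpos (by positivity) (by linarith) (by linarith)
            rw [div_rpow (by positivity) (by norm_num)] at h2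
            refine h2.trans_eq ?_
            rw [show δ - 1 = -(1 - δ) by ring, rpow_neg (show (0:ℝ) ≤ 2 by norm_num)]
            field_simp
        _ = a j * (exp 1 * C₁ * 2 ^ (1 - δ) * (x * (1 + L) ^ (δ - 1))) := by
            have : exp ((j : ℝ) + 1) * exp (-j) = exp 1 := by rw [← exp_add]; ring_nf
            rw [← this, hy]; ring
    refine (Finset.sum_le_sum hblock).trans ?_
    rw [← Finset.sum_mul]
    have hsum : ∑ j ∈ Finset.Ico j₀ (⌊L / 2⌋₊ + 1), a j ≤ A := by
      rw [Finset.sum_Ico_eq_sum_range]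
      simp_rw [add_comm j₀]
      exact ((summable_nat_add_iff j₀).2 hsa).sum_le_tsum _ fun j _ => ha0 _
    calc _ ≤ A * (exp 1 * C₁ * 2 ^ (1 - δ) * (x * (1 + L) ^ (δ - 1))) := by gcongr
      _ = _ := by ring
  have hsplit : ∑ m ∈ s with (j₀ : ℝ) ≤ log (x / (m : ℕ)), t m ≤
      ∑ m ∈ s with L / 2 ≤ log (x / (m : ℕ)), t m +
      ∑ m ∈ s with ((j₀ : ℝ) ≤ log (x / (m : ℕ)) ∧ log (x / m) < L / 2), t m := by
    rw [← Finset.sum_union]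
    · refine Finset.sum_le_sum_of_subset_of_nonneg ?_ fun m hm _ => ?_
      · intro m hm
        obtain ⟨hm1, hm2⟩ := Finset.mem_filter.1 hm
        rw [Finset.mem_union, Finset.mem_filter, Finset.mem_filter]
        rcases le_or_gt (L / 2) (log (x / m)) with h | h
        · exact Or.inl ⟨hm1, h⟩
        · exact Or.inr ⟨hm1, hm2, h⟩
      · rcases Finset.mem_union.1 hm with h | h <;> exact ht0 m (Finset.mem_filter.1 h).1
    · rw [Finset.disjoint_filter]
      intro m _ h1 h2
      exact absurd h2.2 (not_lt.2 h1)
  refine hsplit.trans ((add_le_add part1 part2).trans ?_)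
  have e1 : 0 ≤ exp 1 * C₁ * 2 ^ (1 - δ) * (x * (1 + L) ^ (δ - 1) * (1 + L) ^ (-ρ)) := by positivity
  have e2 : 0 ≤ C₂ * 2 ^ (1 + ρ) * (x * (1 + L) ^ (δ - 1) * A) := by positivity
  nlinarith [e1, e2]

lemma sumUpTo_mono {f : ℕ → ℝ} (hf : ∀ m, 0 ≤ f m) : Monotone (sumUpTo f) := by
  intro x y hxy
  refine Finset.sum_le_sum_of_subset_of_nonneg ?_ fun m _ _ => hf m
  exact Finset.Ioc_subset_Ioc_right (Nat.floor_le_floor hxy)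

lemma sumUpTo_nonneg {f : ℕ → ℝ} (hf : ∀ m, 0 ≤ f m) (x : ℝ) : 0 ≤ sumUpTo f x :=
  Finset.sum_nonneg fun m _ => hf m

lemma tendsto_log_mul_div_log {v : ℝ} (hv : 0 < v) :
    Tendsto (fun x : ℝ => log (x * v) / log x) atTop (nhds 1) := by
  have h : Tendsto (fun x : ℝ => 1 + log v / log x) atTop (nhds (1 + 0)) :=
    (tendsto_const_nhds.div_atTop tendsto_log_atTop).const_add 1
  rw [add_zero] at h
  refine h.congr' ?_
  filter_upwards [eventually_gt_atTop 1] with x hx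
  have hl : 0 < log x := log_pos hx
  rw [log_mul (by positivity) hv.ne']
  field_simp

/-- Scaling of functions asymptotic to a multiple of `x (log x) ^ (δ - 1)`. -/
lemma tendsto_scale {F : ℝ → ℝ} {δ a v : ℝ} (hv : 0 < v)
    (hF : Tendsto (fun x => F x / (x * log x ^ (δ - 1))) atTop (nhds a)) :
    Tendsto (fun x => F (x * v) / (x * log x ^ (δ - 1))) atTop (nhds (a * v)) := by
  have h1 : Tendsto (fun x : ℝ => x * v) atTop atTop := tendsto_id.atTop_mul_const hv
  have h2 := hF.comp h1
  have h3 : Tendsto (fun x : ℝ => (log (x * v) / log x) ^ (δ - 1)) atTop (nhds (1 ^ (δ - 1))) :=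
    (tendsto_log_mul_div_log hv).rpow_const (Or.inl one_ne_zero)
  rw [one_rpow] at h3
  have h4 := (h2.mul h3).mul_const v
  rw [mul_one] at h4
  refine h4.congr' ?_
  filter_upwards [eventually_gt_atTop 1, h1.eventually (eventually_gt_atTop 1)] with x hx hxv
  have hl : 0 < log x := log_pos hx
  have hl2 : 0 < log (x * v) := log_pos hxv
  have hx0 : 0 < x := by linarith
  simp only [Function.comp]
  rw [div_rpow hl2.le hl.le]
  field_simp

lemma sum_Ioc_eq_sumUpTo_sub (f : ℕ → ℝ) {a b : ℝ} (hab : a ≤ b) :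
    ∑ m ∈ Finset.Ioc ⌊a⌋₊ ⌊b⌋₊, f m = sumUpTo f b - sumUpTo f a := by
  have h := Nat.floor_le_floor hab
  rw [sumUpTo, sumUpTo, eq_sub_iff_add_eq, add_comm]
  exact Finset.sum_Ioc_consecutive f (Nat.zero_le _) h

lemma sum_mul_div_eq_integral {f : ℕ → ℝ} (hf0 : f 0 = 0) (δ : ℝ) {x Y : ℝ} (hx : 0 < x)
    (hY : 1 ≤ Y) :
    ∑ m ∈ Finset.Ioc ⌊x * Y⁻¹⌋₊ ⌊x⌋₊, (log (x / m) - δ * (x / m)) * f m =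
      -δ * sumUpTo f x - (log Y - δ * Y) * sumUpTo f (x * Y⁻¹) +
      ∫ v in Y⁻¹..1, (1 / v - δ / v ^ 2) * sumUpTo f (x * v) := by
  have hY0 : 0 < Y := by linarith
  have hYi : Y⁻¹ ≤ 1 := inv_le_one_of_one_le₀ hY
  have hle : x * Y⁻¹ ≤ x := mul_le_of_le_one_right hx.le hYi
  have hp : 0 < x * Y⁻¹ := by positivity
  have hd : ∀ t : ℝ, 0 < t → HasDerivAt (fun t => log (x / t) - δ * (x / t))
      (-(1 / t) + δ * x / t ^ 2) t := by
    intro t ht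
    have h1 : HasDerivAt (fun t => x / t) (-x / t ^ 2) t := by
      have := (hasDerivAt_inv ht.ne').const_mul x
      exact this.congr_deriv (by field_simp)
    have h2 := (h1.log (by positivity)).sub (h1.const_mul δ)
    refine h2.congr_deriv ?_
    field_simp
    ring
  have hsum : ∀ t : ℝ, ∑ k ∈ Finset.Icc 0 ⌊t⌋₊, f k = sumUpTo f t := by
    intro t
    rw [sumUpTo, ← Finset.add_sum_Ioc_eq_sum_Icc (Nat.zero_le _), hf0, zero_add]
  have hcont : ContinuousOn (fun t : ℝ => -(1 / t) + δ * x / t ^ 2) (Set.Icc (x * Y⁻¹) x) := by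
    intro t ht
    have : t ≠ 0 := (hp.trans_le ht.1).ne'
    apply ContinuousAt.continuousWithinAt
    fun_prop (disch := simp [this])
  have key := sum_mul_eq_sub_sub_integral_mul f hp.le hle
    (fun t ht => (hd t (hp.trans_le ht.1)).differentiableAt)
    (hcont.integrableOn_Icc.congr_fun (fun t ht => (hd t (hp.trans_le ht.1)).deriv.symm)
      measurableSet_Icc)
  rw [key]
  simp only [hsum]
  have e1 : x / (x * Y⁻¹) = Y := by field_simp
  have e2 : ∫ t in Set.Ioc (x * Y⁻¹) x, deriv (fun t => log (x / t) - δ * (x / t)) t * sumUpTo f t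
      = -∫ v in Y⁻¹..1, (1 / v - δ / v ^ 2) * sumUpTo f (x * v) := by
    rw [← intervalIntegral.integral_of_le hle]
    have h := intervalIntegral.smul_integral_comp_mul_left (a := Y⁻¹) (b := 1)
      (fun t => deriv (fun t => log (x / t) - δ * (x / t)) t * sumUpTo f t) x
    rw [mul_one] at h
    rw [← h, smul_eq_mul, ← intervalIntegral.integral_const_mul,
      ← intervalIntegral.integral_neg]
    refine intervalIntegral.integral_congr fun v hv => ?_
    rw [Set.uIcc_of_le hYi] at hv
    have hv0 : 0 < v := (inv_pos.2 hY0).trans_le hv.1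
    rw [(hd (x * v) (by positivity)).deriv]
    field_simp
    ring
  rw [e1, e2, div_self hx.ne', log_one]
  ring

/-- Asymptotics of the part of `∑ f m r(x / m)` with `m` of order `x`. -/
lemma exists_tendsto_local {f g : ℕ → ℝ} {δ a : ℝ} (hf : ∀ m, 0 ≤ f m) (hf0 : f 0 = 0)
    (ha : Tendsto (fun x => sumUpTo f x / (x * log x ^ (δ - 1))) atTop (nhds a))
    {Y : ℝ} (hY : 1 ≤ Y) :
    ∃ κ, Tendsto (fun x => (∑ m ∈ Finset.Ioc ⌊x * Y⁻¹⌋₊ ⌊x⌋₊,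
      f m * (sumUpTo g (x / m) + log (x / m) - δ * (x / m))) / (x * log x ^ (δ - 1)))
      atTop (nhds κ) := by
  have hY0 : 0 < Y := by linarith
  have hYi : Y⁻¹ ≤ 1 := inv_le_one_of_one_le₀ hY
  have hYi0 : 0 < Y⁻¹ := by positivity
  set D : ℝ → ℝ := fun x => x * log x ^ (δ - 1) with hD
  -- the arithmetic part
  have hA : ∀ x : ℝ, 0 < x → ∑ m ∈ Finset.Ioc ⌊x * Y⁻¹⌋₊ ⌊x⌋₊, f m * sumUpTo g (x / m) =
      ∑ n ∈ Finset.Ioc 0 ⌊Y⌋₊, g n * (sumUpTo f (x * (n : ℝ)⁻¹) - sumUpTo f (x * Y⁻¹)) := by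
    intro x hx
    have hp : 0 < x * Y⁻¹ := by positivity
    have hR : ∀ n ∈ Finset.Ioc 0 ⌊Y⌋₊,
        g n * (sumUpTo f (x * (n : ℝ)⁻¹) - sumUpTo f (x * Y⁻¹)) =
        ∑ m ∈ Finset.Ioc ⌊x * Y⁻¹⌋₊ ⌊x * (n : ℝ)⁻¹⌋₊, f m * g n := by
      intro n hn
      obtain ⟨hn0, hn1⟩ := (mem_Ioc_floor_iff hY0.le).1 hn
      rw [← sum_Ioc_eq_sumUpTo_sub, Finset.mul_sum]
      · exact Finset.sum_congr rfl fun m _ => mul_comm _ _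
      · gcongr
    rw [Finset.sum_congr rfl hR]
    simp_rw [sumUpTo, Finset.mul_sum]
    refine Finset.sum_comm' fun m n => ?_
    have hi : ∀ y : ℝ, 0 ≤ y → ∀ k : ℕ, k ≤ ⌊y⌋₊ ↔ (k : ℝ) ≤ y := fun y hy k => Nat.le_floor_iff hy
    simp only [Finset.mem_Ioc]
    rw [Nat.floor_lt hp.le, hi x hx.le, hi Y hY0.le, hi (x / m) (by positivity),
      hi (x * (n : ℝ)⁻¹) (by positivity)]
    constructor
    · rintro ⟨⟨h1, h2⟩, h3, h4⟩
      have hm : (0 : ℝ) < m := hp.trans h1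
      have hn : (0 : ℝ) < n := by exact_mod_cast h3
      rw [le_div_iff₀ hm] at h4
      rw [← div_eq_mul_inv, div_lt_iff₀ hY0] at h1
      refine ⟨⟨?_, ?_⟩, h3, ?_⟩
      · rw [← div_eq_mul_inv, div_lt_iff₀ hY0]; exact h1
      · rw [← div_eq_mul_inv, le_div_iff₀ hn]; linarith
      · by_contra hc
        have := mul_lt_mul_of_pos_right (not_le.1 hc) hm
        linarith
    · rintro ⟨⟨h1, h2⟩, h3, h4⟩
      have hm : (0 : ℝ) < m := hp.trans h1
      have hn : (0 : ℝ) < n := by exact_mod_cast h3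
      have hn1 : (1 : ℝ) ≤ n := by exact_mod_cast h3
      rw [← div_eq_mul_inv, le_div_iff₀ hn] at h2
      refine ⟨⟨h1, ?_⟩, h3, ?_⟩
      · nlinarith
      · rw [le_div_iff₀ hm]; linarith
  have limA : Tendsto (fun x => (∑ n ∈ Finset.Ioc 0 ⌊Y⌋₊,
      g n * (sumUpTo f (x * (n : ℝ)⁻¹) - sumUpTo f (x * Y⁻¹))) / D x) atTop
      (nhds (∑ n ∈ Finset.Ioc 0 ⌊Y⌋₊, g n * (a * (n : ℝ)⁻¹ - a * Y⁻¹))) := by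
    simp_rw [Finset.sum_div]
    refine tendsto_finsetSum _ fun n hn => ?_
    have hn0 : (0 : ℝ) < n := by exact_mod_cast (Finset.mem_Ioc.1 hn).1
    have := ((tendsto_scale (inv_pos.2 hn0) ha).sub (tendsto_scale hYi0 ha)).const_mul (g n)
    refine this.congr fun x => ?_
    rw [← sub_div, mul_div_assoc]
  -- the smooth part
  have limB : Tendsto (fun x => ∫ v in Y⁻¹..1, (1 / v - δ / v ^ 2) * sumUpTo f (x * v) / D x) atTop
      (nhds (∫ v in Y⁻¹..1, (1 / v - δ / v ^ 2) * (a * v))) := by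
    have hcont : ContinuousOn (fun v : ℝ => (1 / v - δ / v ^ 2)) (Set.uIcc Y⁻¹ 1) := by
      intro t ht
      rw [Set.uIcc_of_le hYi] at ht
      have : t ≠ 0 := (hYi0.trans_le ht.1).ne'
      apply ContinuousAt.continuousWithinAt
      fun_prop (disch := simp [this])
    refine intervalIntegral.tendsto_integral_filter_of_dominated_convergence
      (fun v => |1 / v - δ / v ^ 2| * (a + 1)) ?_ ?_ ?_ ?_
    · refine Eventually.of_forall fun x => ?_
      refine Measurable.aestronglyMeasurable ?_
      have := (sumUpTo_mono hf).measurable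
      fun_prop
    · filter_upwards [eventually_gt_atTop 1, ha.eventually (gt_mem_nhds (lt_add_one a))]
        with x hx hxa
      refine MeasureTheory.ae_of_all _ fun v hv => ?_
      rw [Set.uIoc_of_le hYi] at hv
      have hx0 : 0 < x := by linarith
      have hD0 : 0 < D x := mul_pos hx0 (rpow_pos_of_pos (log_pos hx) _)
      rw [mul_div_assoc, norm_mul, Real.norm_eq_abs, Real.norm_eq_abs,
        abs_of_nonneg (div_nonneg (sumUpTo_nonneg hf _) hD0.le)]
      gcongr
      refine le_trans ?_ hxa.le
      have hmn : sumUpTo f (x * v) ≤ sumUpTo f x :=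
        sumUpTo_mono hf (mul_le_of_le_one_right hx0.le hv.2)
      gcongr
    · exact (hcont.abs.mul continuousOn_const).intervalIntegrable
    · refine MeasureTheory.ae_of_all _ fun v hv => ?_
      rw [Set.uIoc_of_le hYi] at hv
      have := (tendsto_scale (hYi0.trans hv.1) ha).const_mul (1 / v - δ / v ^ 2)
      refine this.congr fun x => ?_
      rw [mul_div_assoc]
  refine ⟨_, (limA.add (((ha.const_mul (-δ)).sub
    ((tendsto_scale hYi0 ha).const_mul (log Y - δ * Y))).add limB)).congr' ?_⟩
  filter_upwards [eventually_gt_atTop 0] with x hx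
  have hs : ∑ m ∈ Finset.Ioc ⌊x * Y⁻¹⌋₊ ⌊x⌋₊,
      f m * (sumUpTo g (x / m) + log (x / m) - δ * (x / m)) =
      ∑ m ∈ Finset.Ioc ⌊x * Y⁻¹⌋₊ ⌊x⌋₊, f m * sumUpTo g (x / m) +
      ∑ m ∈ Finset.Ioc ⌊x * Y⁻¹⌋₊ ⌊x⌋₊, (log (x / m) - δ * (x / m)) * f m := by
    rw [← Finset.sum_add_distrib]
    exact Finset.sum_congr rfl fun m _ => by ring
  rw [hs, hA x hx, sum_mul_div_eq_integral hf0 δ hx hY]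
  simp_rw [div_eq_mul_inv _ (D x)]
  rw [intervalIntegral.integral_mul_const]
  simp only [hD]
  ring

lemma exists_tendsto_of_forall_approx {q : ℝ → ℝ}
    (h : ∀ η > 0, ∃ κ, ∀ᶠ x in atTop, |q x - κ| ≤ η) : ∃ K, Tendsto q atTop (nhds K) := by
  apply cauchy_map_iff_exists_tendsto.1
  rw [Metric.cauchy_iff]
  refine ⟨inferInstance, fun ε hε => ?_⟩
  obtain ⟨κ, hκ⟩ := h (ε / 3) (by positivity)
  refine ⟨q '' {x | |q x - κ| ≤ ε / 3}, image_mem_map hκ, ?_⟩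
  rintro _ ⟨x, hx, rfl⟩ _ ⟨y, hy, rfl⟩
  rw [Real.dist_eq]
  simp only [Set.mem_ofPred_eq, abs_le] at hx hy
  rw [abs_lt]
  constructor <;> linarith [hx.1, hx.2, hy.1, hy.2]

lemma meanSum_eq (f : ℕ → ℝ) (u : ℝ) :
    meanSum f u = sumUpTo (fun m => f m / m) (exp u) - sumUpTo f (exp u) * exp (-u) := by
  rw [meanSum, sumUpTo, sumUpTo, Finset.sum_mul, ← Finset.sum_sub_distrib]
  exact Finset.sum_congr rfl fun m _ => by ring

/-- Two-term asymptotics for the summatory function of `f ≥ 0` satisfying a convolution identity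
`f log = f * g`, where the summatory function of `g` is `δ y + O(y / (log y) ^ (1 + ρ))`. -/
theorem exists_second_order {f g : ℕ → ℝ} {δ ρ C₂ Cr : ℝ} (hf : ∀ m, 0 ≤ f m) (hf0 : f 0 = 0)
    (hδ0 : 0 < δ) (hδ1 : δ < 1) (hρ : 0 < ρ)
    (hid : ∀ x, 1 ≤ x → sumUpTo f x * log x =
      ∑ m ∈ Finset.Ioc 0 ⌊x⌋₊, f m * (sumUpTo g (x / m) + log (x / m)))
    (hg : ∀ y, 1 ≤ y → |sumUpTo g y + log y - δ * y| ≤ Cr * (y * (1 + log y) ^ (-(1 + ρ))))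
    (hT : ∀ x, 1 ≤ x → sumUpTo (fun m => f m / m) x ≤ C₂ * (1 + log x) ^ δ) :
    ∃ A K, Tendsto (fun u => u * (meanSum f u * u ^ (-δ) - A)) atTop (nhds (-K)) ∧
      Tendsto (fun u => u * (u ^ (1 - δ) * (sumUpTo f (exp u) * exp (-u)) - δ * A)) atTop
        (nhds ((1 - δ) * K)) := by
  set r : ℝ → ℝ := fun y => sumUpTo g y + log y - δ * y with hr
  set T : ℝ → ℝ := sumUpTo (fun m => f m / m) with hTdef
  set Q : ℝ → ℝ := fun x => ∑ m ∈ Finset.Ioc 0 ⌊x⌋₊, f m * r (x / m) with hQdef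
  have hCr : 0 ≤ Cr := by
    have := (abs_nonneg _).trans (hg 1 le_rfl)
    simpa using this
  have hdiv : ∀ x, 1 ≤ x → ∀ m ∈ Finset.Ioc 0 ⌊x⌋₊, 0 < (m : ℝ) ∧ (m : ℝ) ≤ x ∧ 1 ≤ x / m := by
    intro x hx m hm
    obtain ⟨h0, h1⟩ := (mem_Ioc_floor_iff (by linarith)).1 hm
    have h0' : (0 : ℝ) < m := by exact_mod_cast h0
    exact ⟨h0', h1, (one_le_div h0').2 h1⟩
  have hQ : ∀ x, 1 ≤ x → sumUpTo f x * log x = δ * x * T x + Q x := by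
    intro x hx
    rw [hid x hx, hTdef, sumUpTo, hQdef, Finset.mul_sum, ← Finset.sum_add_distrib]
    refine Finset.sum_congr rfl fun m hm => ?_
    simp only [hr]
    ring
  -- upper bound for the summatory function
  obtain ⟨C₁, hC₁, hS⟩ : ∃ C₁, 0 ≤ C₁ ∧
      ∀ x, 1 ≤ x → sumUpTo f x ≤ C₁ * x * (1 + log x) ^ (δ - 1) := by
    have hT1 := hT 1 le_rfl
    have hC₂ : 0 ≤ C₂ := by
      simp only [log_one, add_zero, one_rpow, mul_one] at hT1
      exact (sumUpTo_nonneg (fun m => div_nonneg (hf m) (Nat.cast_nonneg _)) _).trans hT1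
    refine ⟨(δ + Cr + 1) * C₂, by positivity, fun x hx => ?_⟩
    have hl : 0 ≤ log x := log_nonneg hx
    have h1 : sumUpTo f x ≤ x * T x := by
      rw [hTdef, sumUpTo, sumUpTo, Finset.mul_sum]
      refine Finset.sum_le_sum fun m hm => ?_
      obtain ⟨h0, h1, -⟩ := hdiv x hx m hm
      rw [mul_div_assoc', le_div_iff₀ h0, mul_comm x]
      exact mul_le_mul_of_nonneg_left h1 (hf m)
    have h2 : Q x ≤ Cr * x * T x := by
      rw [hTdef, sumUpTo, Finset.mul_sum]
      refine Finset.sum_le_sum fun m hm => ?_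
      obtain ⟨h0, h1, h2⟩ := hdiv x hx m hm
      have h3 := (le_abs_self _).trans (hg _ h2)
      have h4 : (1 + log (x / m)) ^ (-(1 + ρ)) ≤ 1 :=
        rpow_le_one_of_one_le_of_nonpos (by linarith [log_nonneg h2]) (by linarith)
      calc f m * r (x / m) ≤ f m * (Cr * (x / m * 1)) := by
            refine mul_le_mul_of_nonneg_left (h3.trans ?_) (hf m)
            gcongr
        _ = Cr * x * (f m / m) := by ring
    have h3 : sumUpTo f x * (1 + log x) ≤ (δ + Cr + 1) * x * (C₂ * (1 + log x) ^ δ) := by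
      calc sumUpTo f x * (1 + log x) = sumUpTo f x + sumUpTo f x * log x := by ring
        _ ≤ (δ + Cr + 1) * x * T x := by rw [hQ x hx]; linarith
        _ ≤ _ := by
          have := hT x hx
          have : 0 < x := by linarith
          gcongr
    rw [rpow_sub (by linarith), rpow_one, ← mul_div_assoc, le_div_iff₀ (by linarith)]
    linarith
  -- tail bounds for the error term
  set E : ℕ → ℝ := fun j₀ => ∑' j : ℕ, (1 + ((j + j₀ : ℕ) : ℝ)) ^ (-(1 + ρ)) with hE
  have hE0 : Tendsto E atTop (nhds 0) :=
    tendsto_sum_nat_add fun j : ℕ => (1 + (j : ℝ)) ^ (-(1 + ρ))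
  obtain ⟨C₃, hC₃, htail⟩ : ∃ C₃, 0 ≤ C₃ ∧ ∀ x, 1 ≤ x → ∀ j₀ : ℕ,
      |∑ m ∈ Finset.Ioc 0 ⌊x⌋₊ with (j₀ : ℝ) ≤ log (x / (m : ℕ)), f m * r (x / m)| ≤
        C₃ * (x * (1 + log x) ^ (δ - 1) * (E j₀ + (1 + log x) ^ (-ρ))) := by
    have hC₂ : 0 ≤ C₂ := by
      have hT1 := hT 1 le_rfl
      simp only [log_one, add_zero, one_rpow, mul_one] at hT1
      exact (sumUpTo_nonneg (fun m => div_nonneg (hf m) (Nat.cast_nonneg _)) _).trans hT1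
    refine ⟨Cr * (exp 1 * C₁ * 2 ^ (1 - δ) + C₂ * 2 ^ (1 + ρ)), by positivity, fun x hx j₀ => ?_⟩
    rw [mul_assoc]
    refine le_trans ?_ (mul_le_mul_of_nonneg_left
      (weighted_tail_le hf hδ1 hρ hC₁ hS hT hx j₀) hCr)
    refine (Finset.abs_sum_le_sum_abs _ _).trans ?_
    rw [Finset.mul_sum]
    refine Finset.sum_le_sum fun m hm => ?_
    obtain ⟨h0, h1, h2⟩ := hdiv x hx m (Finset.mem_filter.1 hm).1
    rw [abs_mul, abs_of_nonneg (hf m), mul_left_comm]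
    exact mul_le_mul_of_nonneg_left (hg _ h2) (hf m)
  -- the differential equation
  set σ : ℝ → ℝ := fun u => sumUpTo f (exp u) * exp (-u) with hσ
  set h : ℝ → ℝ := fun u => u * σ u - δ * meanSum f u with hh
  have hhQ : ∀ u, 0 ≤ u → h u = exp (-u) * Q (exp u) + δ * σ u := by
    intro u hu
    have h1 := hQ (exp u) (one_le_exp hu)
    rw [log_exp] at h1
    have h2 : exp u * exp (-u) = 1 := by rw [← exp_add]; simp
    simp only [hh, hσ, meanSum_eq]
    have h3 : exp (-u) * (sumUpTo f (exp u) * u) =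
        exp (-u) * (δ * exp u * T (exp u) + Q (exp u)) := by
      rw [h1]
    linear_combination h3 + δ * T (exp u) * h2
  have hP : ∀ u, (1 : ℝ) ≤ u → HasDerivWithinAt (fun v => meanSum f v * v ^ (-δ))
      (u ^ (-δ - 1) * h u) (Set.Ici u) u := by
    intro u hu
    have hu0 : 0 < u := by linarith
    have h1 := (meanSum_hasDerivWithinAt f u).mul
      ((hasDerivAt_rpow_const (p := -δ) (Or.inl hu0.ne')).hasDerivWithinAt (s := Set.Ici u))
    refine h1.congr_deriv ?_
    have h2 : u ^ (-δ) = u ^ (-δ - 1) * u := by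
      rw [← rpow_add_one hu0.ne']; ring_nf
    simp only [hh, hσ]
    rw [h2]
    ring
  have hPc : ContinuousOn (fun v => meanSum f v * v ^ (-δ)) (Set.Ici 1) := by
    refine (continuous_meanSum f).continuousOn.mul ?_
    refine continuousOn_id.rpow_const fun v hv => Or.inl ?_
    have : (1 : ℝ) ≤ v := hv
    simp only [id]
    positivity
  have hsq : ∀ u : ℝ, 0 < u → ∀ y, u ^ 2 * (u ^ (-δ - 1) * y) = u ^ (1 - δ) * y := by
    intro u hu y
    rw [← mul_assoc, ← rpow_natCast, ← rpow_add hu]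
    norm_num
    ring_nf
    simp
  have hmono : ∀ u : ℝ, 0 < u → (1 + u) ^ (δ - 1) ≤ u ^ (δ - 1) := fun u hu =>
    rpow_le_rpow_of_nonpos hu (by linarith) (by linarith)
  have hcancel : ∀ u : ℝ, 0 < u → u ^ (1 - δ) * u ^ (δ - 1) = 1 := fun u hu => by
    rw [← rpow_add hu]; simp
  obtain ⟨M, hM⟩ : ∃ M, ∀ u, (1 : ℝ) ≤ u → |u ^ (1 - δ) * h u| ≤ M := by
    refine ⟨C₃ * (E 0 + 1) + δ * C₁, fun u hu => ?_⟩
    have hu0 : 0 < u := by linarith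
    have h0 := one_le_exp hu0.le
    have hE00 : 0 ≤ E 0 := tsum_nonneg fun j => by positivity
    have h1 := htail (exp u) h0 0
    have hfil : (Finset.Ioc 0 ⌊exp u⌋₊).filter (fun m : ℕ => ((0 : ℕ) : ℝ) ≤ log (exp u / m)) =
        Finset.Ioc 0 ⌊exp u⌋₊ := by
      refine Finset.filter_true_of_mem fun m hm => ?_
      simpa using log_nonneg (hdiv _ h0 m hm).2.2
    rw [hfil, log_exp] at h1
    have h1' : |Q (exp u)| ≤ C₃ * (exp u * u ^ (δ - 1) * (E 0 + 1)) := by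
      refine h1.trans ?_
      have e1 := hmono u hu0
      have e2 : (1 + u) ^ (-ρ) ≤ 1 :=
        rpow_le_one_of_one_le_of_nonpos (by linarith) (by linarith)
      gcongr
    have h2 : σ u ≤ C₁ * u ^ (δ - 1) := by
      have := hS (exp u) h0
      rw [log_exp] at this
      calc σ u ≤ C₁ * exp u * (1 + u) ^ (δ - 1) * exp (-u) := by simp only [hσ]; gcongr
        _ = C₁ * (1 + u) ^ (δ - 1) * (exp u * exp (-u)) := by ring
        _ = C₁ * (1 + u) ^ (δ - 1) := by rw [← exp_add]; simp
        _ ≤ _ := by have := hmono u hu0; gcongr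
    have hσ0 : 0 ≤ σ u := mul_nonneg (sumUpTo_nonneg hf _) (exp_pos _).le
    have h3 : |h u| ≤ u ^ (δ - 1) * (C₃ * (E 0 + 1) + δ * C₁) := by
      rw [hhQ u hu0.le]
      refine (abs_add_le _ _).trans ?_
      rw [abs_mul, abs_of_pos (exp_pos _), abs_of_nonneg (mul_nonneg hδ0.le hσ0)]
      calc exp (-u) * |Q (exp u)| + δ * σ u
          ≤ exp (-u) * (C₃ * (exp u * u ^ (δ - 1) * (E 0 + 1))) + δ * (C₁ * u ^ (δ - 1)) := by
            gcongr
        _ = (exp (-u) * exp u) * (C₃ * (u ^ (δ - 1) * (E 0 + 1))) + δ * (C₁ * u ^ (δ - 1)) := by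
            ring
        _ = _ := by
            rw [← exp_add]
            simp
            ring
    rw [abs_mul, abs_of_nonneg (rpow_nonneg hu0.le _)]
    calc u ^ (1 - δ) * |h u| ≤ u ^ (1 - δ) * (u ^ (δ - 1) * (C₃ * (E 0 + 1) + δ * C₁)) := by
          gcongr
      _ = _ := by rw [← mul_assoc, hcancel u hu0, one_mul]
  obtain ⟨A, hA⟩ := exists_tendsto_of_deriv_right_le one_pos hPc hP (M := M) (fun u hu => by
    have hu0 : 0 < u := by linarith
    have := hM u hu
    rw [← hsq u hu0, abs_mul, abs_of_pos (show 0 < u ^ 2 by positivity)] at this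
    rw [le_div_iff₀ (by positivity)]
    linarith)
  -- first-order asymptotics
  have hσeq : ∀ u, 0 < u → u ^ (1 - δ) * σ u =
      δ * (meanSum f u * u ^ (-δ)) + (u ^ (1 - δ) * h u) / u := by
    intro u hu
    have h2 : u ^ (1 - δ) = u ^ (-δ) * u := by
      rw [← rpow_add_one hu.ne']; ring_nf
    simp only [hh]
    rw [h2]
    field_simp
    ring
  have hsmall : Tendsto (fun u => (u ^ (1 - δ) * h u) / u) atTop (nhds 0) := by
    refine squeeze_zero_norm' (a := fun u => M / u) ?_ (tendsto_const_nhds.div_atTop tendsto_id)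
    filter_upwards [eventually_ge_atTop 1] with u hu
    have hu0 : 0 < u := by linarith
    rw [norm_div, Real.norm_eq_abs, Real.norm_eq_abs, abs_of_pos hu0]
    have := hM u hu
    gcongr
  have hσlim : Tendsto (fun u => u ^ (1 - δ) * σ u) atTop (nhds (δ * A)) := by
    have := (hA.const_mul δ).add hsmall
    rw [add_zero] at this
    refine this.congr' ?_
    filter_upwards [eventually_gt_atTop 0] with u hu
    exact (hσeq u hu).symm
  have hDeq : ∀ x : ℝ, 1 < x → ∀ y, y / (x * log x ^ (δ - 1)) =
      log x ^ (1 - δ) * (y * exp (-log x)) := by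
    intro x hx y
    have hl := log_pos hx
    have hx0 : 0 < x := by linarith
    rw [exp_neg, exp_log hx0, show δ - 1 = -(1 - δ) by ring, rpow_neg hl.le]
    have : 0 < log x ^ (1 - δ) := rpow_pos_of_pos hl _
    field_simp
  have ha : Tendsto (fun x => sumUpTo f x / (x * log x ^ (δ - 1))) atTop (nhds (δ * A)) := by
    refine (hσlim.comp tendsto_log_atTop).congr' ?_
    filter_upwards [eventually_gt_atTop 1] with x hx
    simp only [Function.comp, hσ]
    rw [hDeq x hx, exp_log (by linarith)]
  -- the error term has a limit
  obtain ⟨K₀, hK₀⟩ : ∃ K₀, Tendsto (fun x => Q x / (x * log x ^ (δ - 1))) atTop (nhds K₀) := by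
    refine exists_tendsto_of_forall_approx fun η hη => ?_
    have hE1 : ∀ᶠ j in atTop, C₃ * E j < η / 3 := by
      have := hE0.const_mul C₃
      rw [mul_zero] at this
      exact this.eventually (gt_mem_nhds (by positivity))
    obtain ⟨J, hJ⟩ := hE1.exists
    have hY : 1 ≤ exp (J : ℝ) := one_le_exp (Nat.cast_nonneg J)
    obtain ⟨κ, hκ⟩ := exists_tendsto_local (g := g) hf hf0 ha hY
    refine ⟨κ, ?_⟩
    have hρlim : Tendsto (fun x : ℝ => C₃ * (1 + log x) ^ (-ρ)) atTop (nhds (C₃ * 0)) :=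
      ((tendsto_rpow_neg_atTop hρ).comp
        (tendsto_atTop_add_const_left _ 1 tendsto_log_atTop)).const_mul _
    rw [mul_zero] at hρlim
    have hκ' := hκ.eventually (Metric.closedBall_mem_nhds κ (show 0 < η / 3 by positivity))
    filter_upwards [eventually_gt_atTop 1, hκ',
      hρlim.eventually (gt_mem_nhds (show 0 < η / 3 by positivity))] with x hx hx1 hx2
    have hx0 : 0 < x := by linarith
    have hl := log_pos hx
    have hD0 : 0 < x * log x ^ (δ - 1) := mul_pos hx0 (rpow_pos_of_pos hl _)
    rw [Real.dist_eq] at hx1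
    have hsplit : Q x = ∑ m ∈ Finset.Ioc ⌊x * (exp (J : ℝ))⁻¹⌋₊ ⌊x⌋₊,
          f m * (sumUpTo g (x / m) + log (x / m) - δ * (x / m)) +
        ∑ m ∈ Finset.Ioc 0 ⌊x⌋₊ with (J : ℝ) ≤ log (x / (m : ℕ)), f m * r (x / m) := by
      simp only [hQdef]
      rw [← Finset.sum_filter_not_add_sum_filter (Finset.Ioc 0 ⌊x⌋₊)
        (fun m : ℕ => (J : ℝ) ≤ log (x / m))]
      congr 1
      refine Finset.sum_congr ?_ fun m _ => rfl
      ext m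
      rw [Finset.mem_filter, mem_Ioc_floor_iff hx0.le, Finset.mem_Ioc,
        Nat.floor_lt (by positivity), Nat.le_floor_iff hx0.le, not_le]
      constructor
      · rintro ⟨⟨h1, h2⟩, h3⟩
        have hm : (0 : ℝ) < m := by exact_mod_cast h1
        rw [log_lt_iff_lt_exp (by positivity), div_lt_iff₀ hm] at h3
        refine ⟨?_, h2⟩
        rw [← div_eq_mul_inv, div_lt_iff₀ (exp_pos _)]
        linarith
      · rintro ⟨h1, h2⟩
        have hm : (0 : ℝ) < m := lt_of_le_of_lt (by positivity) h1
        refine ⟨⟨by exact_mod_cast hm, h2⟩, ?_⟩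
        rw [log_lt_iff_lt_exp (by positivity), div_lt_iff₀ hm]
        rw [← div_eq_mul_inv, div_lt_iff₀ (exp_pos _)] at h1
        linarith
    have ht := htail x hx.le J
    set tl := ∑ m ∈ Finset.Ioc 0 ⌊x⌋₊ with (J : ℝ) ≤ log (x / (m : ℕ)), f m * r (x / m)
    have ht2 : |tl / (x * log x ^ (δ - 1))| ≤ C₃ * E J + C₃ * (1 + log x) ^ (-ρ) := by
      have hEJ : 0 ≤ E J := tsum_nonneg fun j => by positivity
      rw [abs_div, abs_of_pos hD0, div_le_iff₀ hD0]
      refine ht.trans ?_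
      calc _ ≤ C₃ * (x * log x ^ (δ - 1) * (E J + (1 + log x) ^ (-ρ))) := by
            have := hmono _ hl
            gcongr
        _ = _ := by ring
    rw [hsplit, add_div, add_sub_right_comm]
    refine (abs_add_le _ _).trans ?_
    linarith
  have hK : Tendsto (fun u => u ^ (1 - δ) * h u) atTop (nhds (K₀ + δ * (δ * A))) := by
    have h1 : Tendsto (fun u => Q (exp u) / (exp u * log (exp u) ^ (δ - 1))) atTop (nhds K₀) :=
      hK₀.comp tendsto_exp_atTop
    refine (h1.add (hσlim.const_mul δ)).congr' ?_
    filter_upwards [eventually_gt_atTop 0] with u hu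
    rw [hhQ u hu.le, hDeq (exp u) (one_lt_exp_iff.2 hu), log_exp]
    ring
  set K := K₀ + δ * (δ * A)
  have hV : Tendsto (fun u => u * (meanSum f u * u ^ (-δ) - A)) atTop (nhds (-K)) := by
    refine tendsto_mul_sub_of_deriv_right one_pos hPc hP ?_ hA
    refine hK.congr' ?_
    filter_upwards [eventually_gt_atTop 0] with u hu
    exact (hsq u hu _).symm
  refine ⟨A, K, hV, ?_⟩
  have := (hV.const_mul δ).add hK
  rw [show δ * -K + K = (1 - δ) * K by ring] at this
  refine this.congr' ?_
  filter_upwards [eventually_gt_atTop 0] with u hu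
  have h2 := hσeq u hu
  simp only [hσ] at h2
  rw [h2]
  field_simp
  ring

/-- The coefficients of `X` times the logarithmic derivative of `F`, for the power series `F` with
coefficients `c`, `c 0 = 1`. -/
noncomputable def newtonCoeff (c : ℕ → ℝ) (k : ℕ) : ℝ :=
  k * c k - ∑ j : Fin k, c (k - j) * newtonCoeff c j

lemma newtonCoeff_eq (c : ℕ → ℝ) (k : ℕ) :
    newtonCoeff c k = k * c k - ∑ j ∈ Finset.range k, c (k - j) * newtonCoeff c j := by
  rw [newtonCoeff, Finset.sum_range (fun j => c (k - j) * newtonCoeff c j)]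

@[simp] lemma newtonCoeff_zero (c : ℕ → ℝ) : newtonCoeff c 0 = 0 := by
  rw [newtonCoeff_eq]; simp

@[simp] lemma newtonCoeff_one (c : ℕ → ℝ) : newtonCoeff c 1 = c 1 := by
  rw [newtonCoeff_eq]; simp

lemma sum_mul_newtonCoeff {c : ℕ → ℝ} (h0 : c 0 = 1) (k : ℕ) :
    ∑ j ∈ Finset.range (k + 1), c (k - j) * newtonCoeff c j = k * c k := by
  rw [Finset.sum_range_succ, newtonCoeff_eq c k, Nat.sub_self, h0]
  ring

lemma abs_newtonCoeff_add_two_le {c : ℕ → ℝ} (hc : ∀ k, c k = 0 ∨ c k = 1) (m : ℕ) :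
    |newtonCoeff c (m + 2)| ≤ (m + 2) + ∑ j ∈ Finset.range (m + 1), |newtonCoeff c j| := by
  have hm : (0 : ℝ) ≤ m := Nat.cast_nonneg m
  have key : ∀ (a : ℝ) (d : ℕ → ℝ), |a| ≤ m + 2 → (∀ j, |d j| ≤ 1) →
      newtonCoeff c (m + 2) = a - ∑ j ∈ Finset.range (m + 1), d j * newtonCoeff c j →
      |newtonCoeff c (m + 2)| ≤ (m + 2) + ∑ j ∈ Finset.range (m + 1), |newtonCoeff c j| := by
    intro a d ha hd h
    rw [h]
    refine (abs_sub _ _).trans (add_le_add ha ?_)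
    refine (Finset.abs_sum_le_sum_abs _ _).trans (Finset.sum_le_sum fun j _ => ?_)
    rw [abs_mul]
    exact mul_le_of_le_one_left (abs_nonneg _) (hd j)
  have h2 := newtonCoeff_eq c (m + 2)
  rw [Finset.sum_range_succ] at h2
  have e : m + 2 - (m + 1) = 1 := by omega
  rw [e] at h2
  rcases hc 1 with h1 | h1
  · refine key (((m + 2 : ℕ) : ℝ) * c (m + 2)) (fun j => c (m + 2 - j)) ?_ ?_ ?_
    · push_cast
      rw [abs_le]
      rcases hc (m + 2) with h | h <;> rw [h] <;> constructor <;> linarith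
    · intro j
      rcases hc (m + 2 - j) with h | h <;> simp [h]
    · rw [h2, h1]; ring
  · have h3 := newtonCoeff_eq c (m + 1)
    rw [h1, h3] at h2
    refine key (((m + 2 : ℕ) : ℝ) * c (m + 2) - ((m + 1 : ℕ) : ℝ) * c (m + 1))
      (fun j => c (m + 2 - j) - c (m + 1 - j)) ?_ ?_ ?_
    · push_cast
      rw [abs_le]
      rcases hc (m + 2) with h | h <;> rcases hc (m + 1) with h' | h' <;> rw [h, h'] <;>
        constructor <;> linarith
    · intro j
      rcases hc (m + 2 - j) with h | h <;> rcases hc (m + 1 - j) with h' | h' <;> simp [h, h']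
    · rw [h2]
      simp only [sub_mul, Finset.sum_sub_distrib]
      ring

lemma abs_newtonCoeff_le {c : ℕ → ℝ} (hc : ∀ k, c k = 0 ∨ c k = 1) (k : ℕ) :
    |newtonCoeff c k| ≤ 6 * (7 / 4 : ℝ) ^ k := by
  induction k using Nat.strong_induction_on with
  | _ k ih =>
    match k with
    | 0 => simp
    | 1 => rcases hc 1 with h | h <;> norm_num [h]
    | m + 2 =>
      refine (abs_newtonCoeff_add_two_le hc m).trans ?_
      have h1 : ∑ j ∈ Finset.range (m + 1), |newtonCoeff c j| ≤
          ∑ j ∈ Finset.range (m + 1), 6 * (7 / 4 : ℝ) ^ j :=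
        Finset.sum_le_sum fun j hj => ih j (by have := Finset.mem_range.1 hj; omega)
      rw [← Finset.mul_sum, geom_sum_eq (by norm_num),
        show (7 / 4 - 1 : ℝ) = 3 / 4 by norm_num] at h1
      have h2 := one_add_mul_le_pow (show (-2 : ℝ) ≤ 3 / 4 by norm_num) (m + 2)
      have h3 : (1 + 3 / 4 : ℝ) = 7 / 4 := by norm_num
      rw [h3] at h2
      push_cast at h2
      have h4 : (7 / 4 : ℝ) ^ (m + 2) = 7 / 4 * (7 / 4 : ℝ) ^ (m + 1) := by ring
      rw [h4] at h2 ⊢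
      have : (0 : ℝ) ≤ m := Nat.cast_nonneg m
      linarith

/-- The coefficients of minus the logarithmic derivative of `F`, where `F` is the Dirichlet series of the
multiplicative function `f`. -/
noncomputable def logDerivCoeff (f : ℕ → ℝ) (n : ℕ) : ℝ :=
  if IsPrimePow n then
    newtonCoeff (fun k => f (n.minFac ^ k)) (n.factorization n.minFac) * log n.minFac
  else 0

lemma logDerivCoeff_prime_pow (f : ℕ → ℝ) {p : ℕ} (hp : p.Prime) (k : ℕ) :
    logDerivCoeff f (p ^ k) = newtonCoeff (fun k => f (p ^ k)) k * log p := by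
  rcases eq_or_ne k 0 with rfl | hk
  · simp [logDerivCoeff, not_isPrimePow_one]
  · rw [logDerivCoeff, if_pos (hp.isPrimePow.pow hk), hp.pow_minFac hk, hp.factorization_pow]
    simp

lemma logDerivCoeff_prime (f : ℕ → ℝ) {p : ℕ} (hp : p.Prime) :
    logDerivCoeff f p = f p * log p := by
  have := logDerivCoeff_prime_pow f hp 1
  simpa using this

lemma sum_divisors_logDerivCoeff {f : ArithmeticFunction ℝ} (hf : f.IsMultiplicative) (n : ℕ) :
    ∑ d ∈ n.divisors, logDerivCoeff f d * f (n / d) = f n * log n := by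
  refine Nat.recOnPrimeCoprime ?_ ?_ ?_ n
  · simp
  · intro p k hp
    rw [Nat.sum_divisors_prime_pow hp]
    have h := sum_mul_newtonCoeff (c := fun k => f (p ^ k)) (by simp [hf.1]) k
    have e : ∀ j ∈ Finset.range (k + 1), logDerivCoeff f (p ^ j) * f (p ^ k / p ^ j) =
        (f (p ^ (k - j)) * newtonCoeff (fun k => f (p ^ k)) j) * log p := fun j hj => by
      rw [logDerivCoeff_prime_pow f hp,
        Nat.pow_div (by have := Finset.mem_range.1 hj; omega) hp.pos]
      ring
    rw [Finset.sum_congr rfl e, ← Finset.sum_mul, h]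
    push_cast
    rw [log_pow]
    ring
  · intro a b ha' hb' hab ha hb
    have ha0 : 0 < a := by omega
    have hb0 : 0 < b := by omega
    have red : ∀ n : ℕ, ∑ d ∈ n.divisors, logDerivCoeff f d * f (n / d) =
        ∑ d ∈ n.divisors with IsPrimePow d, logDerivCoeff f d * f (n / d) := fun n => by
      rw [Finset.sum_filter]
      refine Finset.sum_congr rfl fun d _ => ?_
      by_cases h : IsPrimePow d <;> simp [h, logDerivCoeff]
    have ea : ∑ d ∈ a.divisors with IsPrimePow d, logDerivCoeff f d * f (a * b / d) =
        (f a * log a) * f b := by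
      rw [← ha, red a, Finset.sum_mul]
      refine Finset.sum_congr rfl fun d hd => ?_
      have hda := Nat.dvd_of_mem_divisors (Finset.mem_filter.1 hd).1
      rw [Nat.mul_div_right_comm hda, hf.2 (Nat.Coprime.of_dvd_left (Nat.div_dvd_of_dvd hda) hab),
        mul_assoc]
    have eb : ∑ d ∈ b.divisors with IsPrimePow d, logDerivCoeff f d * f (a * b / d) =
        f a * (f b * log b) := by
      rw [← hb, red b, Finset.mul_sum]
      refine Finset.sum_congr rfl fun d hd => ?_
      have hda := Nat.dvd_of_mem_divisors (Finset.mem_filter.1 hd).1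
      rw [Nat.mul_div_assoc _ hda, hf.2 (Nat.Coprime.of_dvd_right (Nat.div_dvd_of_dvd hda) hab)]
      ring
    rw [red (a * b), Nat.mul_divisors_filter_prime_pow hab, Finset.filter_union,
      Finset.sum_union (Nat.disjoint_divisors_filter_isPrimePow hab), ea, eb, hf.2 hab,
      Nat.cast_mul, log_mul (by positivity) (by positivity)]
    ring

lemma sumUpTo_mul_log_eq {f : ArithmeticFunction ℝ} (hf : f.IsMultiplicative) {x : ℝ}
    (hx : 1 ≤ x) :
    sumUpTo f x * log x = ∑ m ∈ Finset.Ioc 0 ⌊x⌋₊,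
      f m * (sumUpTo (logDerivCoeff f) (x / m) + log (x / m)) := by
  let g : ArithmeticFunction ℝ := ⟨logDerivCoeff f, by simp [logDerivCoeff, not_isPrimePow_zero]⟩
  have h := ArithmeticFunction.sum_Ioc_mul_eq_sum_sum f g ⌊x⌋₊
  have h1 : ∀ n, (f * g) n = f n * log n := fun n => by
    rw [mul_comm, ArithmeticFunction.mul_apply, Nat.sum_divisorsAntidiagonal (fun i j => g i * f j)]
    exact sum_divisors_logDerivCoeff hf n
  simp only [h1] at h
  have h2 : ∀ m ∈ Finset.Ioc 0 ⌊x⌋₊,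
      f m * (sumUpTo (logDerivCoeff f) (x / m) + log (x / m)) =
      f m * ∑ k ∈ Finset.Ioc 0 (⌊x⌋₊ / m), g k + (f m * log x - f m * log m) := fun m hm => by
    have hm0 : (0 : ℝ) < m := by exact_mod_cast (Finset.mem_Ioc.1 hm).1
    rw [sumUpTo, Nat.floor_div_natCast, log_div (by positivity) hm0.ne']
    change _ = f m * ∑ k ∈ Finset.Ioc 0 (⌊x⌋₊ / m), logDerivCoeff f k + _
    ring
  rw [Finset.sum_congr rfl h2, Finset.sum_add_distrib, ← h, Finset.sum_sub_distrib, sumUpTo,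
    Finset.sum_mul]
  ring

lemma summable_logDerivCoeff_sub_prime {f : ℕ → ℝ} (hf : ∀ n, f n = 0 ∨ f n = 1) :
    Summable fun n : ℕ => |logDerivCoeff f n - if n.Prime then f n * log n else 0| *
      (n : ℝ) ^ (-(9 / 10) : ℝ) := by
  set q : ℝ := 7 / 4 * 2 ^ (-(9 / 10) : ℝ) with hq
  have hq0 : 0 < q := by positivity
  have hq1 : q < 1 := by
    have h : (7 / 4 : ℝ) < 2 ^ (9 / 10 : ℝ) := by
      refine lt_of_pow_lt_pow_left₀ 10 (by positivity) ?_
      rw [← rpow_natCast (2 ^ (9 / 10 : ℝ)), ← rpow_mul (by norm_num)]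
      norm_num
    rw [hq, rpow_neg (by norm_num), ← div_eq_mul_inv, div_lt_one (by positivity)]
    exact h
  set φ : Nat.Primes × ℕ → ℕ := fun x => (x.1 : ℕ) ^ (x.2 + 1) with hφ
  have hinj : Function.Injective φ := fun x y h => by
    apply Nat.Primes.prodNatEquiv.injective
    exact Subtype.ext h
  rw [← hinj.summable_iff]
  · have hs1 : Summable fun p : Nat.Primes =>
        6 * (49 / 16) / q * ((p : ℝ) ^ (-(8 / 5) : ℝ) * 5) := by
      have h1 := (Real.summable_nat_rpow.2 (show (-(8 / 5) : ℝ) < -1 by norm_num))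
      exact ((h1.comp_injective Nat.Primes.coe_nat_injective).mul_right 5).mul_left _
    have hs2 : Summable fun k : ℕ => q ^ k := summable_geometric_of_lt_one hq0.le hq1
    refine Summable.of_nonneg_of_le (fun x => by simp only [Function.comp]; positivity) ?_
      (hs1.mul_of_nonneg hs2 (fun p => by positivity) (fun k => by positivity))
    rintro ⟨p, k⟩
    have hp := p.2
    have hp2 : (2 : ℝ) ≤ p := by exact_mod_cast hp.two_le
    have hp0 : (0 : ℝ) < p := by linarith
    simp only [hφ, Function.comp]
    rw [logDerivCoeff_prime_pow f hp]
    rcases k with _ | k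
    · simp [hp]
      positivity
    · have hnp : ¬ Nat.Prime ((p : ℕ) ^ (k + 1 + 1)) := Nat.Prime.not_prime_pow (by omega)
      have h1 := abs_newtonCoeff_le (c := fun k => f ((p : ℕ) ^ k)) (fun k => hf _) (k + 1 + 1)
      have hlog0 : 0 ≤ log p := log_nonneg (by linarith)
      rw [if_neg hnp, sub_zero, abs_mul, abs_of_nonneg hlog0]
      have hlog : log p ≤ 5 * (p : ℝ) ^ (1 / 5 : ℝ) := by
        have := log_le_rpow_div hp0.le (show (0 : ℝ) < 1 / 5 by norm_num)
        linarith
      have h3 : (7 / 4 : ℝ) * (p : ℝ) ^ (-(9 / 10) : ℝ) ≤ q := by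
        rw [hq]
        gcongr ?_ * ?_
        exact rpow_le_rpow_of_nonpos (by norm_num) hp2 (by norm_num)
      have h4 : ((p : ℝ) ^ (-(9 / 10) : ℝ)) ^ 2 * (p : ℝ) ^ (1 / 5 : ℝ) =
          (p : ℝ) ^ (-(8 / 5) : ℝ) := by
        rw [← rpow_natCast, ← rpow_mul hp0.le, ← rpow_add hp0]
        norm_num
      have h5 : (((p : ℕ) ^ (k + 1 + 1) : ℕ) : ℝ) ^ (-(9 / 10) : ℝ) =
          ((p : ℝ) ^ (-(9 / 10) : ℝ)) ^ (k + 2) := by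
        push_cast
        rw [← rpow_natCast, ← rpow_mul hp0.le, ← rpow_natCast, ← rpow_mul hp0.le, mul_comm]
      rw [h5]
      set z := (p : ℝ) ^ (-(9 / 10) : ℝ) with hz
      have hz0 : 0 < z := by positivity
      calc |newtonCoeff (fun k => f ((p : ℕ) ^ k)) (k + 1 + 1)| * log p * z ^ (k + 2)
          ≤ 6 * (7 / 4) ^ (k + 1 + 1) * (5 * (p : ℝ) ^ (1 / 5 : ℝ)) * z ^ (k + 2) := by gcongr
        _ = 6 * (49 / 16) * ((z ^ 2 * (p : ℝ) ^ (1 / 5 : ℝ)) * 5) * (7 / 4 * z) ^ k := by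
            rw [mul_pow]; ring
        _ ≤ 6 * (49 / 16) * ((z ^ 2 * (p : ℝ) ^ (1 / 5 : ℝ)) * 5) * q ^ k := by gcongr
        _ = _ := by
            rw [h4, pow_succ]
            field_simp
  · intro n hn
    have hn1 : ¬ IsPrimePow n := fun h => hn
      ⟨Nat.Primes.prodNatEquiv.symm ⟨n, h⟩, by
        have := congrArg Subtype.val (Nat.Primes.prodNatEquiv.apply_symm_apply ⟨n, h⟩)
        exact this⟩
    have hn2 : ¬ n.Prime := fun h => hn1 h.isPrimePow
    simp [logDerivCoeff, hn1, hn2]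

lemma exists_sumUpTo_logDerivCoeff_sub_le {f : ℕ → ℝ} (hf : ∀ n, f n = 0 ∨ f n = 1) :
    ∃ C, ∀ y, 1 ≤ y → |sumUpTo (logDerivCoeff f) y -
      sumUpTo (fun n => if n.Prime then f n * log n else 0) y| ≤ C * y ^ (9 / 10 : ℝ) := by
  have hs := summable_logDerivCoeff_sub_prime hf
  refine ⟨∑' n : ℕ, |logDerivCoeff f n - if n.Prime then f n * log n else 0| *
    (n : ℝ) ^ (-(9 / 10) : ℝ), fun y hy => ?_⟩
  have hy0 : 0 < y := by linarith
  rw [sumUpTo, sumUpTo, ← Finset.sum_sub_distrib]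
  refine (Finset.abs_sum_le_sum_abs _ _).trans ?_
  refine le_trans ?_ (mul_le_mul_of_nonneg_right
    (hs.sum_le_tsum (Finset.Ioc 0 ⌊y⌋₊) fun n _ => by positivity) (by positivity))
  rw [Finset.sum_mul]
  refine Finset.sum_le_sum fun m hm => ?_
  obtain ⟨hm0, hm1⟩ := (mem_Ioc_floor_iff hy0.le).1 hm
  have hm0' : (0 : ℝ) < m := by exact_mod_cast hm0
  rw [mul_assoc]
  refine le_mul_of_one_le_right (abs_nonneg _) ?_
  rw [rpow_neg hm0'.le, ← div_eq_inv_mul, one_le_div (by positivity)]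
  exact rpow_le_rpow hm0'.le hm1 (by norm_num)

lemma exists_one_add_log_rpow_le {r ε : ℝ} (hr : 0 < r) (hε : 0 < ε) :
    ∃ C, 0 < C ∧ ∀ y, 1 ≤ y → (1 + log y) ^ r ≤ C * y ^ ε := by
  have he : 0 < ε / r := by positivity
  refine ⟨(1 + (ε / r)⁻¹) ^ r, by positivity, fun y hy => ?_⟩
  have hy0 : 0 < y := by linarith
  have h1 := log_le_rpow_div hy0.le he
  have h2 : 1 ≤ y ^ (ε / r) := one_le_rpow hy he.le
  have h3 : 1 + log y ≤ (1 + (ε / r)⁻¹) * y ^ (ε / r) := by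
    rw [div_eq_mul_inv] at h1
    linarith
  have h4 : (y ^ (ε / r)) ^ r = y ^ ε := by
    rw [← rpow_mul hy0.le, div_mul_cancel₀ _ hr.ne']
  rw [← h4, ← mul_rpow (by positivity) (by positivity)]
  have := log_nonneg hy
  exact rpow_le_rpow (by positivity) h3 hr.le

lemma continuousOn_log_rpow (a y : ℝ) :
    ContinuousOn (fun t : ℝ => log t ^ a) (Set.Icc 2 y) := by
  intro t ht
  have ht2 : 2 ≤ t := ht.1
  have hl : 0 < log t := log_pos (by linarith)
  exact ((continuousAt_log (by linarith)).rpow_const (Or.inl hl.ne')).continuousWithinAt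

lemma intervalIntegrable_log_rpow (a : ℝ) {y : ℝ} (hy : 2 ≤ y) :
    IntervalIntegrable (fun t : ℝ => log t ^ a) MeasureTheory.volume 2 y :=
  ContinuousOn.intervalIntegrable (by rw [Set.uIcc_of_le hy]; exact continuousOn_log_rpow a y)

lemma exists_integral_log_rpow_neg_le {a : ℝ} (ha : 0 < a) :
    ∃ C, 0 < C ∧ ∀ y, 2 ≤ y → ∫ t in (2 : ℝ)..y, log t ^ (-a) ≤ C * (y * log y ^ (-a)) := by
  have hl2 : 0 < log 2 := log_pos (by norm_num)
  set K := 1 + 2 * a / log 2 with hK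
  have hK0 : 0 < K := by positivity
  refine ⟨2 * K ^ a, by positivity, fun y hy => ?_⟩
  have hy0 : 0 < y := by linarith
  have hly : 0 < log y := log_pos (by linarith)
  have hpt : ∀ t ∈ Set.Icc 2 y,
      log t ^ (-a) ≤ K ^ a * y ^ (1 / 2 : ℝ) * log y ^ (-a) * t ^ (-(1 / 2) : ℝ) := by
    rintro t ⟨ht2, hty⟩
    have ht0 : 0 < t := by linarith
    have hlt : 0 < log t := log_pos (by linarith)
    have hltl : log 2 ≤ log t := log_le_log (by norm_num) ht2
    have hyt : 1 ≤ y / t := (one_le_div ht0).2 hty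
    have he : 0 < 1 / (2 * a) := by positivity
    have h1 := log_le_rpow_div (x := y / t) (by positivity) he
    have h2 : 1 ≤ (y / t) ^ (1 / (2 * a)) := one_le_rpow hyt he.le
    have h3 : log y / log t ≤ K * (y / t) ^ (1 / (2 * a)) := by
      have e : log y = log t + log (y / t) := by rw [log_div hy0.ne' ht0.ne']; ring
      rw [e, add_div, div_self hlt.ne']
      have h4 : log (y / t) / log t ≤ log (y / t) / log 2 :=
        div_le_div_of_nonneg_left (log_nonneg hyt) hl2 hltl
      have h5 : log (y / t) / log 2 ≤ (2 * a / log 2) * (y / t) ^ (1 / (2 * a)) := by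
        rw [div_le_iff₀ hl2]
        refine h1.trans (le_of_eq ?_)
        field_simp
      rw [hK]
      linarith
    have h6 : (log y / log t) ^ a ≤ K ^ a * (y / t) ^ (1 / 2 : ℝ) := by
      refine (rpow_le_rpow (by positivity) h3 ha.le).trans (le_of_eq ?_)
      rw [mul_rpow hK0.le (by positivity), ← rpow_mul (by positivity)]
      congr 2
      field_simp
    rw [div_rpow hly.le hlt.le, div_rpow hy0.le ht0.le] at h6
    rw [rpow_neg hlt.le, rpow_neg hly.le, rpow_neg ht0.le]
    have h7 : 0 < log y ^ a := by positivity
    calc (log t ^ a)⁻¹ = (log y ^ a / log t ^ a) * (log y ^ a)⁻¹ := by field_simp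
      _ ≤ (K ^ a * (y ^ (1 / 2 : ℝ) / t ^ (1 / 2 : ℝ))) * (log y ^ a)⁻¹ := by gcongr
      _ = _ := by ring
  have hI : IntervalIntegrable (fun t : ℝ => t ^ (-(1 / 2) : ℝ)) MeasureTheory.volume 2 y :=
    intervalIntegral.intervalIntegrable_rpow' (by norm_num)
  have h := intervalIntegral.integral_mono_on hy (intervalIntegrable_log_rpow (-a) hy)
    (hI.const_mul (K ^ a * y ^ (1 / 2 : ℝ) * log y ^ (-a))) hpt
  rw [intervalIntegral.integral_const_mul, integral_rpow (Or.inl (by norm_num))] at h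
  refine h.trans ?_
  have h2 : (0 : ℝ) < 2 ^ (1 / 2 : ℝ) := by positivity
  have h3 : y ^ (1 / 2 : ℝ) * y ^ (1 / 2 : ℝ) = y := by
    rw [← rpow_add hy0]; norm_num
  have e : (-(1 / 2) + 1 : ℝ) = 1 / 2 := by norm_num
  rw [e]
  calc K ^ a * y ^ (1 / 2 : ℝ) * log y ^ (-a) * ((y ^ (1 / 2 : ℝ) - 2 ^ (1 / 2 : ℝ)) / (1 / 2))
      ≤ K ^ a * y ^ (1 / 2 : ℝ) * log y ^ (-a) * ((y ^ (1 / 2 : ℝ)) / (1 / 2)) := by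
        gcongr
        linarith
    _ = 2 * K ^ a * ((y ^ (1 / 2 : ℝ) * y ^ (1 / 2 : ℝ)) * log y ^ (-a)) := by ring
    _ = _ := by rw [h3]

lemma hasDerivAt_integral_log_rpow (a : ℝ) {y : ℝ} (hy : 2 ≤ y) :
    HasDerivAt (fun x => ∫ t in (2 : ℝ)..x, log t ^ a) (log y ^ a) y := by
  have hc : ContinuousOn (fun t : ℝ => log t ^ a) (Set.Ioi 1) := fun t ht => by
    have ht1 : 1 < t := ht
    exact ((continuousAt_log (by linarith)).rpow_const
      (Or.inl (log_pos ht1).ne')).continuousWithinAt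
  refine intervalIntegral.integral_hasDerivAt_right (intervalIntegrable_log_rpow a hy) ?_ ?_
  · exact hc.stronglyMeasurableAtFilter isOpen_Ioi y (show 1 < y by linarith)
  · exact hc.continuousAt (Ioi_mem_nhds (by linarith))

lemma Li_eq (x : ℝ) : Li x = ∫ t in (2 : ℝ)..x, log t ^ (-1 : ℝ) := by
  simp only [Li, rpow_neg_one, one_div]

lemma hasDerivAt_Li {y : ℝ} (hy : 2 ≤ y) : HasDerivAt Li (log y)⁻¹ y := by
  have := hasDerivAt_integral_log_rpow (-1) hy
  rw [rpow_neg_one] at this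
  exact this.congr_of_eventuallyEq (Eventually.of_forall Li_eq)

lemma continuousOn_Li_div (y : ℝ) : ContinuousOn (fun t => Li t / t) (Set.Icc 2 y) := fun t ht => by
  have ht2 : 2 ≤ t := ht.1
  exact ((hasDerivAt_Li ht2).continuousAt.div continuousAt_id
    (show t ≠ 0 by linarith)).continuousWithinAt

lemma integral_Li_div {y : ℝ} (hy : 2 ≤ y) :
    ∫ t in (2 : ℝ)..y, Li t / t = Li y * log y - (y - 2) := by
  have h := intervalIntegral.integral_eq_sub_of_hasDerivAt (a := 2) (b := y)
    (f := fun t => Li t * log t - t) (f' := fun t => Li t / t) ?_ ?_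
  · rw [h]
    have : Li 2 = 0 := by simp [Li]
    rw [this]; ring
  · intro t ht
    rw [Set.uIcc_of_le hy] at ht
    have ht2 : 2 ≤ t := ht.1
    have hl : 0 < log t := log_pos (by linarith)
    refine (((hasDerivAt_Li ht2).mul (hasDerivAt_log (by linarith))).sub
      (hasDerivAt_id t)).congr_deriv ?_
    field_simp
    ring
  · exact ContinuousOn.intervalIntegrable (by rw [Set.uIcc_of_le hy]; exact continuousOn_Li_div y)

lemma primeCount_eq_sum (S : Set ℕ) {x : ℝ} (hx : 0 ≤ x) :
    (primeCount S x : ℝ) = ∑ n ∈ Finset.Icc 0 ⌊x⌋₊, if n.Prime ∧ n ∈ S then (1 : ℝ) else 0 := by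
  rw [primeCount, Finset.sum_boole]
  congr 1
  rw [← Set.ncard_coe_finset]
  congr 1
  ext n
  simp [Nat.le_floor_iff hx]
  tauto

lemma sum_log_prime_eq (S : Set ℕ) {x : ℝ} (hx : 2 ≤ x) :
    sumUpTo (fun n => if n.Prime then chiS S n * log n else 0) x =
      primeCount S x * log x - ∫ t in (2 : ℝ)..x, primeCount S t / t := by
  set c : ℕ → ℝ := fun n => if n.Prime ∧ n ∈ S then (1 : ℝ) else 0 with hc
  have h := sum_mul_eq_sub_integral_mul₁ c (f := log) (by simp [hc, Nat.not_prime_zero])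
    (by simp [hc, Nat.not_prime_one]) x
    (fun z hz => differentiableAt_log (by have := hz.1; linarith)) (by
      rw [deriv_log']
      refine ContinuousOn.integrableOn_Icc fun t ht => ?_
      exact (continuousAt_inv₀ (by have := ht.1; linarith)).continuousWithinAt)
  rw [← primeCount_eq_sum S (by linarith), ← intervalIntegral.integral_of_le hx] at h
  have h1 : ∑ k ∈ Finset.Icc 0 ⌊x⌋₊, log k * c k =
      sumUpTo (fun n => if n.Prime then chiS S n * log n else 0) x := by
    rw [sumUpTo, ← Finset.add_sum_Ioc_eq_sum_Icc (Nat.zero_le _)]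
    simp only [Nat.cast_zero, log_zero, zero_mul, zero_add]
    refine Finset.sum_congr rfl fun k _ => ?_
    by_cases hk : k.Prime <;> by_cases hk' : k ∈ S <;> simp [hc, hk, hk', chiS]
  rw [← h1, h, mul_comm]
  congr 1
  refine intervalIntegral.integral_congr fun t ht => ?_
  rw [Set.uIcc_of_le hx] at ht
  have := ht.1
  simp only [deriv_log]
  rw [primeCount_eq_sum S (by linarith), div_eq_mul_inv, mul_comm]

lemma intervalIntegrable_primeCount_div (S : Set ℕ) {x : ℝ} (hx : 2 ≤ x) :
    IntervalIntegrable (fun t => (primeCount S t : ℝ) / t) MeasureTheory.volume 2 x := by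
  have h := integrableOn_mul_sum_Icc (m := 0) (a := 2) (b := x)
    (fun n : ℕ => if n.Prime ∧ n ∈ S then (1 : ℝ) else 0) (by norm_num) (g := fun t : ℝ => t⁻¹)
    (ContinuousOn.integrableOn_Icc fun t ht =>
      (continuousAt_inv₀ (by have := ht.1; linarith)).continuousWithinAt)
  rw [intervalIntegrable_iff_integrableOn_Icc_of_le hx]
  refine h.congr_fun (fun t ht => ?_) measurableSet_Icc
  have := ht.1
  simp only
  rw [primeCount_eq_sum S (by linarith), div_eq_mul_inv, mul_comm]

theorem ConditionB.exists_theta_le {S : Set ℕ} {δ ρ : ℝ} (hδ0 : 0 < δ) (hδ1 : δ < 1) (hρ : 0 < ρ)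
    (hB : ConditionB S δ ρ) :
    ∃ C, ∀ y, 1 ≤ y → |sumUpTo (fun n => if n.Prime then chiS S n * log n else 0) y - δ * y| ≤
      C * (y * (1 + log y) ^ (-(1 + ρ))) := by
  obtain ⟨C, hC⟩ := hB
  have hl2 : 0 < log 2 := log_pos (by norm_num)
  have hC0 : 0 ≤ C := by
    have := (abs_nonneg _).trans (hC 2 le_rfl)
    by_contra hneg
    have h2 : 0 < log 2 ^ (2 + ρ) := by positivity
    have : C * 2 / log 2 ^ (2 + ρ) < 0 := div_neg_of_neg_of_pos (by linarith) h2
    linarith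
  obtain ⟨C₁, hC₁0, hC₁⟩ := exists_one_add_log_rpow_le (r := 1 + ρ) (ε := 1) (by linarith) one_pos
  obtain ⟨C₂, hC₂0, hC₂⟩ := exists_integral_log_rpow_neg_le (a := 2 + ρ) (by linarith)
  set k := 1 + 1 / log 2 with hk
  have hk0 : 0 < k := by positivity
  have hone : ∀ y, 1 ≤ y → 1 ≤ C₁ * (y * (1 + log y) ^ (-(1 + ρ))) := fun y hy => by
    have hl := log_nonneg hy
    have h1 := hC₁ y hy
    rw [rpow_one] at h1
    rw [rpow_neg (by positivity), ← mul_assoc, ← div_eq_mul_inv, one_le_div (by positivity)]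
    exact h1
  refine ⟨2 * C₁ + (C * k ^ (1 + ρ) + C * (C₂ * (1 / log 2) * k ^ (1 + ρ))), fun y hy => ?_⟩
  have hly := log_nonneg hy
  have hy0 : 0 < y := by linarith
  have hn : 0 ≤ y * (1 + log y) ^ (-(1 + ρ)) := by positivity
  have hkn : 0 ≤ C * k ^ (1 + ρ) + C * (C₂ * (1 / log 2) * k ^ (1 + ρ)) := by positivity
  rcases lt_or_ge y 2 with hy2 | hy2
  · have h0 : sumUpTo (fun n => if n.Prime then chiS S n * log n else 0) y = 0 := by
      refine Finset.sum_eq_zero fun m hm => ?_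
      have hm2 := ((mem_Ioc_floor_iff hy0.le).1 hm).2
      have : m < 2 := by
        have : (m : ℝ) < 2 := by linarith
        exact_mod_cast this
      rw [if_neg fun h => absurd h.two_le (by omega)]
    rw [h0, zero_sub, abs_neg, abs_of_pos (by positivity)]
    have h1 := hone y hy
    have h2 : δ * y ≤ 2 := by nlinarith
    nlinarith [mul_nonneg hkn hn]
  · have hlp : 0 < log y := log_pos (by linarith)
    have hl2y : log 2 ≤ log y := log_le_log (by norm_num) hy2
    have hkl : 1 + log y ≤ k * log y := by
      have : 1 ≤ log y / log 2 := (one_le_div hl2).2 hl2y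
      rw [hk, add_mul, one_mul, one_div_mul_eq_div]
      linarith
    have hpow : log y ^ (-(1 + ρ)) ≤ k ^ (1 + ρ) * (1 + log y) ^ (-(1 + ρ)) := by
      rw [rpow_neg hlp.le, rpow_neg (by positivity), ← div_eq_mul_inv, inv_eq_one_div,
        div_le_div_iff₀ (by positivity) (by positivity), one_mul, ← mul_rpow hk0.le hlp.le]
      exact rpow_le_rpow (by positivity) hkl (by linarith)
    have hsplit : log y ^ (-(2 + ρ)) * log y = log y ^ (-(1 + ρ)) := by
      rw [← rpow_add_one hlp.ne']
      congr 1
      ring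
    have hLiI : IntervalIntegrable (fun t => Li t / t) MeasureTheory.volume 2 y :=
      ContinuousOn.intervalIntegrable (by rw [Set.uIcc_of_le hy2]; exact continuousOn_Li_div y)
    have hPI := intervalIntegrable_primeCount_div S hy2
    have e : sumUpTo (fun n => if n.Prime then chiS S n * log n else 0) y - δ * y =
        -(2 * δ) + ((primeCount S y - δ * Li y) * log y -
          ∫ t in (2 : ℝ)..y, ((primeCount S t : ℝ) / t - δ * (Li t / t))) := by
      rw [sum_log_prime_eq S hy2, intervalIntegral.integral_sub hPI (hLiI.const_mul δ),
        intervalIntegral.integral_const_mul, integral_Li_div hy2]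
      ring
    have b1 : |(primeCount S y - δ * Li y) * log y| ≤
        C * k ^ (1 + ρ) * (y * (1 + log y) ^ (-(1 + ρ))) := by
      rw [abs_mul, abs_of_pos hlp]
      calc _ ≤ C * y / log y ^ (2 + ρ) * log y := by gcongr; exact hC y hy2
        _ = C * y * (log y ^ (-(2 + ρ)) * log y) := by rw [rpow_neg hlp.le]; ring
        _ ≤ C * y * (k ^ (1 + ρ) * (1 + log y) ^ (-(1 + ρ))) := by rw [hsplit]; gcongr
        _ = _ := by ring
    have b2 : |∫ t in (2 : ℝ)..y, ((primeCount S t : ℝ) / t - δ * (Li t / t))| ≤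
        C * (C₂ * (1 / log 2) * k ^ (1 + ρ)) * (y * (1 + log y) ^ (-(1 + ρ))) := by
      have hm : |∫ t in (2 : ℝ)..y, ((primeCount S t : ℝ) / t - δ * (Li t / t))| ≤
          ∫ t in (2 : ℝ)..y, C * log t ^ (-(2 + ρ)) := by
        have := intervalIntegral.norm_integral_le_of_norm_le (a := 2) (b := y)
          (f := fun t => (primeCount S t : ℝ) / t - δ * (Li t / t))
          (g := fun t => C * log t ^ (-(2 + ρ))) (μ := MeasureTheory.volume) hy2
          (MeasureTheory.ae_of_all _ fun t ht => ?_)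
          ((intervalIntegrable_log_rpow _ hy2).const_mul C)
        · exact this
        · have ht2 : 2 < t := ht.1
          have hlt : 0 < log t := log_pos (by linarith)
          have h1 := hC t ht2.le
          rw [norm_eq_abs, show (primeCount S t : ℝ) / t - δ * (Li t / t) =
            ((primeCount S t : ℝ) - δ * Li t) / t by ring, abs_div,
            abs_of_pos (by linarith : 0 < t),
            div_le_iff₀ (by linarith), rpow_neg hlt.le]
          refine h1.trans (le_of_eq ?_)
          ring
      rw [intervalIntegral.integral_const_mul] at hm
      refine hm.trans ?_
      calc C * ∫ t in (2 : ℝ)..y, log t ^ (-(2 + ρ))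
          ≤ C * (C₂ * (y * log y ^ (-(2 + ρ)))) := by gcongr; exact hC₂ y hy2
        _ ≤ C * (C₂ * (y * ((1 / log 2) * (log y ^ (-(2 + ρ)) * log y)))) := by
            gcongr
            have : 1 ≤ (1 / log 2) * log y := by
              rw [one_div_mul_eq_div]; exact (one_le_div hl2).2 hl2y
            calc log y ^ (-(2 + ρ)) = 1 * log y ^ (-(2 + ρ)) := (one_mul _).symm
              _ ≤ ((1 / log 2) * log y) * log y ^ (-(2 + ρ)) := by gcongr
              _ = _ := by ring
        _ ≤ C * (C₂ * (y * ((1 / log 2) * (k ^ (1 + ρ) * (1 + log y) ^ (-(1 + ρ)))))) := by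
            rw [hsplit]; gcongr
        _ = _ := by ring
    rw [e]
    refine (abs_add_le _ _).trans ?_
    have b3 := (abs_sub ((primeCount S y - δ * Li y) * log y)
      (∫ t in (2 : ℝ)..y, ((primeCount S t : ℝ) / t - δ * (Li t / t))))
    have b4 : |-(2 * δ)| ≤ 2 * C₁ * (y * (1 + log y) ^ (-(1 + ρ))) := by
      rw [abs_neg, abs_of_pos (by positivity)]
      have := hone y hy
      nlinarith
    linarith

/-- The characteristic function of a set of positive integers, as an arithmetic function. -/
noncomputable def charArith (S : Set ℕ) : ArithmeticFunction ℝ :=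
  ⟨fun n => if n = 0 then 0 else chiS S n, by simp⟩

lemma charArith_apply {S : Set ℕ} {n : ℕ} (hn : n ≠ 0) : charArith S n = chiS S n := if_neg hn

lemma charArith_eq_zero_or_one (S : Set ℕ) (n : ℕ) : charArith S n = 0 ∨ charArith S n = 1 := by
  rcases eq_or_ne n 0 with rfl | hn
  · simp
  · rw [charArith_apply hn, chiS]
    split_ifs <;> simp

lemma charArith_nonneg (S : Set ℕ) (n : ℕ) : 0 ≤ charArith S n := by
  rcases charArith_eq_zero_or_one S n with h | h <;> rw [h]
  exact zero_le_one

lemma charArith_le_one (S : Set ℕ) (n : ℕ) : charArith S n ≤ 1 := by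
  rcases charArith_eq_zero_or_one S n with h | h <;> rw [h]
  exact zero_le_one

lemma IsMultiplicativeSet.charArith {S : Set ℕ} (hS : IsMultiplicativeSet S) :
    (charArith S).IsMultiplicative := by
  refine ⟨by rw [charArith_apply one_ne_zero, chiS, if_pos hS.1], fun {m n} hmn => ?_⟩
  rcases Nat.eq_zero_or_pos m with rfl | hm
  · simp
  rcases Nat.eq_zero_or_pos n with rfl | hn
  · simp
  rw [charArith_apply hm.ne', charArith_apply hn.ne', charArith_apply (by positivity)]
  have := hS.2 m n hm hn hmn
  by_cases h1 : m ∈ S <;> by_cases h2 : n ∈ S <;> simp [chiS, this, h1, h2]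

lemma setCount_eq_sumUpTo (S : Set ℕ) {x : ℝ} (hx : 0 ≤ x) :
    (setCount S x : ℝ) = sumUpTo (charArith S) x := by
  have h : sumUpTo (charArith S) x = ∑ n ∈ Finset.Ioc 0 ⌊x⌋₊, if n ∈ S then (1 : ℝ) else 0 := by
    refine Finset.sum_congr rfl fun n hn => ?_
    rw [charArith_apply (by have := Finset.mem_Ioc.1 hn; omega), chiS]
  rw [h, setCount, Finset.sum_boole]
  congr 1
  rw [← Set.ncard_coe_finset]
  congr 1
  ext n
  simp [Nat.le_floor_iff hx]
  tauto

lemma exists_logDerivCoeff_le {S : Set ℕ} {δ ρ : ℝ} (hδ0 : 0 < δ) (hδ1 : δ < 1) (hρ : 0 < ρ)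
    (hB : ConditionB S δ ρ) :
    ∃ C, ∀ y, 1 ≤ y → |sumUpTo (logDerivCoeff (charArith S)) y + log y - δ * y| ≤
      C * (y * (1 + log y) ^ (-(1 + ρ))) := by
  obtain ⟨C₁, h₁⟩ := hB.exists_theta_le hδ0 hδ1 hρ
  obtain ⟨C₂, h₂⟩ := exists_sumUpTo_logDerivCoeff_sub_le (charArith_eq_zero_or_one S)
  obtain ⟨C₃, hC₃, h₃⟩ := exists_one_add_log_rpow_le (r := 1 + ρ) (ε := 1 / 10) (by linarith)
    (by norm_num)
  obtain ⟨C₄, hC₄, h₄⟩ := exists_one_add_log_rpow_le (r := 2 + ρ) (ε := 1) (by linarith)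
    (by norm_num)
  refine ⟨C₁ + |C₂| * C₃ + C₄, fun y hy => ?_⟩
  have hy0 : 0 < y := by linarith
  have hl := log_nonneg hy
  have e : sumUpTo (fun n => if n.Prime then charArith S n * log n else 0) y =
      sumUpTo (fun n => if n.Prime then chiS S n * log n else 0) y := by
    refine Finset.sum_congr rfl fun n hn => ?_
    have hn0 : n ≠ 0 := by have := Finset.mem_Ioc.1 hn; omega
    simp only [charArith_apply hn0]
  have b1 := h₁ y hy
  have b2 := h₂ y hy
  rw [e] at b2
  have b3 : C₂ * y ^ (9 / 10 : ℝ) ≤ |C₂| * C₃ * (y * (1 + log y) ^ (-(1 + ρ))) := by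
    have h := h₃ y hy
    have e1 : y = y ^ (1 / 10 : ℝ) * y ^ (9 / 10 : ℝ) := by
      rw [← rpow_add hy0]; norm_num
    rw [mul_assoc]
    refine mul_le_mul (le_abs_self _) ?_ (by positivity) (abs_nonneg _)
    rw [rpow_neg (by positivity), ← mul_assoc, ← div_eq_mul_inv, le_div_iff₀ (by positivity)]
    calc _ ≤ y ^ (9 / 10 : ℝ) * (C₃ * y ^ (1 / 10 : ℝ)) := by gcongr
      _ = C₃ * (y ^ (1 / 10 : ℝ) * y ^ (9 / 10 : ℝ)) := by ring
      _ = _ := by rw [← e1]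
  have b4 : log y ≤ C₄ * (y * (1 + log y) ^ (-(1 + ρ))) := by
    have h := h₄ y hy
    rw [rpow_one, show 2 + ρ = 1 + (1 + ρ) by ring, rpow_add (by positivity), rpow_one] at h
    rw [rpow_neg (by positivity), ← mul_assoc, ← div_eq_mul_inv, le_div_iff₀ (by positivity)]
    refine le_trans ?_ h
    gcongr
    linarith
  rw [abs_le] at b1 b2 ⊢
  constructor <;> linarith

lemma LSeries'_eq (S : Set ℕ) {s : ℝ} (hs : 0 < s) :
    LSeries' S s = ∑' n : ℕ, charArith S n * (n : ℝ) ^ (-s) := by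
  refine tsum_congr fun n => ?_
  rcases eq_or_ne n 0 with rfl | hn
  · simp [zero_rpow (neg_ne_zero.2 hs.ne')]
  · rw [charArith_apply hn, chiS]
    split_ifs <;> simp

lemma summable_charArith_mul_rpow (S : Set ℕ) {s : ℝ} (hs : 1 < s) :
    Summable fun n : ℕ => charArith S n * (n : ℝ) ^ (-s) := by
  refine Summable.of_nonneg_of_le (fun n => mul_nonneg (charArith_nonneg S n) (by positivity))
    (fun n => ?_) (Real.summable_nat_rpow.2 (show -s < -1 by linarith))
  exact mul_le_of_le_one_left (by positivity) (charArith_le_one S n)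

lemma differentiableAt_LSeries' (S : Set ℕ) {s : ℝ} (hs : 1 < s) :
    DifferentiableAt ℝ (LSeries' S) s := by
  have hab : LSeries.abscissaOfAbsConv (fun n => ((charArith S n : ℝ) : ℂ)) ≤ 1 :=
    LSeries.abscissaOfAbsConv_le_of_le_const ⟨1, fun n _ => by
      rw [Complex.norm_real, norm_eq_abs, abs_of_nonneg (charArith_nonneg S n)]
      exact charArith_le_one S n⟩
  have hd := (LSeries_hasDerivAt (s := (s : ℂ)) (hab.trans_lt (by
    rw [Complex.ofReal_re]; exact_mod_cast hs))).real_of_complex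
  refine (hd.congr_of_eventuallyEq ?_).differentiableAt
  filter_upwards [Ioi_mem_nhds hs] with t ht
  have ht0 : (0 : ℝ) < t := lt_trans zero_lt_one ht
  have : LSeries (fun n => ((charArith S n : ℝ) : ℂ)) t = ((LSeries' S t : ℝ) : ℂ) := by
    rw [LSeries'_eq S ht0, LSeries, Complex.ofReal_tsum]
    refine tsum_congr fun n => ?_
    rcases eq_or_ne n 0 with rfl | hn
    · simp
    · rw [LSeries.term_of_ne_zero hn, Complex.ofReal_mul, Complex.ofReal_cpow (by positivity)]
      push_cast
      rw [Complex.cpow_neg, div_eq_mul_inv]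
  rw [this, Complex.ofReal_re]

lemma LSeries'_pos {S : Set ℕ} (h1 : 1 ∈ S) {s : ℝ} (hs : 1 < s) : 0 < LSeries' S s := by
  rw [LSeries'_eq S (by linarith)]
  refine (summable_charArith_mul_rpow S hs).tsum_pos
    (fun n => mul_nonneg (charArith_nonneg S n) (by positivity)) 1 ?_
  simp [charArith_apply, chiS, h1]

theorem IsEulerKronecker.exists_tendsto {S : Set ℕ} {δ γS : ℝ} (h1 : 1 ∈ S)
    (hEK : IsEulerKronecker S δ γS) :
    ∃ c, 0 < c ∧ Tendsto (fun ε => (LSeries' S (1 + ε) * ε ^ δ - c) / ε)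
      (nhdsWithin 0 (Set.Ioi 0)) (nhds (c * γS)) := by
  set Φ : ℝ → ℝ := fun ε => log (LSeries' S (1 + ε)) + δ * log ε with hΦ
  set φ : ℝ → ℝ := fun ε => deriv (LSeries' S) (1 + ε) / LSeries' S (1 + ε) + δ / ε with hφ
  have hd : ∀ ε, 0 < ε → HasDerivAt Φ (φ ε) ε := fun ε hε => by
    have h2 := (differentiableAt_LSeries' S (show 1 < 1 + ε by linarith)).hasDerivAt
    have h3 : HasDerivAt (fun ε => LSeries' S (1 + ε)) (deriv (LSeries' S) (1 + ε)) ε := by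
      have := h2.comp ε ((hasDerivAt_id ε).const_add 1)
      exact this.congr_deriv (mul_one _)
    have h4 := (h3.log (LSeries'_pos h1 (by linarith)).ne').add
      ((hasDerivAt_log hε.ne').const_mul δ)
    exact h4.congr_deriv (by simp only [hφ, div_eq_mul_inv])
  have hlim : Tendsto φ (nhdsWithin 0 (Set.Ioi 0)) (nhds γS) := by
    have ht : Tendsto (fun ε : ℝ => 1 + ε) (nhdsWithin 0 (Set.Ioi 0))
        (nhdsWithin 1 (Set.Ioi 1)) := by
      refine tendsto_nhdsWithin_iff.2 ⟨?_, ?_⟩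
      · have : Tendsto (fun ε : ℝ => 1 + ε) (nhds 0) (nhds (1 + 0)) :=
          tendsto_const_nhds.add tendsto_id
        rw [add_zero] at this
        exact this.mono_left nhdsWithin_le_nhds
      · filter_upwards [self_mem_nhdsWithin] with ε hε
        have : (0 : ℝ) < ε := hε
        exact (show (1 : ℝ) < 1 + ε by linarith)
    have := hEK.comp ht
    refine this.congr fun ε => ?_
    simp [hφ]
  have hbd : ∀ᶠ ε in nhdsWithin 0 (Set.Ioi 0), |φ ε| < |γS| + 1 :=
    hlim.abs.eventually (gt_mem_nhds (by linarith))
  obtain ⟨b, hb, hsub⟩ := mem_nhdsGT_iff_exists_Ioo_subset.1 hbd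
  have hb0 : (0 : ℝ) < b := hb
  have hK : 0 ≤ |γS| + 1 := by positivity
  have hlip : LipschitzOnWith (|γS| + 1).toNNReal Φ (Set.Ioo 0 b) := by
    refine (convex_Ioo 0 b).lipschitzOnWith_of_nnnorm_hasDerivWithin_le
      (fun x hx => (hd x hx.1).hasDerivWithinAt) fun x hx => ?_
    have : |φ x| < |γS| + 1 := hsub hx
    rw [← NNReal.coe_le_coe, coe_nnnorm, Real.coe_toNNReal _ hK]
    exact this.le
  obtain ⟨Ψ, hΨ, hΨeq⟩ := hlip.extend_real
  have heq : ∀ x ∈ Set.Ioo 0 b, Ψ =ᶠ[nhds x] Φ := fun x hx =>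
    Filter.mem_of_superset (Ioo_mem_nhds hx.1 hx.2) fun y hy => (hΨeq hy).symm
  have hmem : Set.Ioo 0 b ∈ nhdsWithin (0 : ℝ) (Set.Ioi 0) := Ioo_mem_nhdsGT hb0
  have hΨd : HasDerivWithinAt Ψ γS (Set.Ici 0) 0 := by
    refine hasDerivWithinAt_Ici_of_tendsto_deriv (s := Set.Ioo 0 b) (fun x hx => ?_)
      hΨ.continuous.continuousWithinAt hmem ?_
    · exact ((hd x hx.1).congr_of_eventuallyEq (heq x hx)).differentiableAt.differentiableWithinAt
    · refine hlim.congr' ?_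
      filter_upwards [hmem] with x hx
      exact ((hd x hx.1).congr_of_eventuallyEq (heq x hx)).deriv.symm
  have hE := hΨd.exp
  refine ⟨exp (Ψ 0), exp_pos _, ?_⟩
  have hE' := hasDerivWithinAt_iff_tendsto_slope.1 hE
  rw [Set.Ici_sdiff_left] at hE'
  refine hE'.congr' ?_
  filter_upwards [hmem] with ε hε
  have hε0 := hε.1
  have hΨε : Ψ ε = Φ ε := (hΨeq hε).symm
  rw [slope_def_field, sub_zero, hΨε, hΦ]
  simp only
  rw [exp_add, exp_log (LSeries'_pos h1 (by linarith)), rpow_def_of_pos hε0, mul_comm δ]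

lemma exists_sumUpTo_div_le {S : Set ℕ} {δ c : ℝ} (hδ0 : 0 < δ)
    (hc : Tendsto (fun ε => LSeries' S (1 + ε) * ε ^ δ) (nhdsWithin 0 (Set.Ioi 0)) (nhds c)) :
    ∃ C, ∀ x, 1 ≤ x → sumUpTo (fun m => charArith S m / m) x ≤ C * (1 + log x) ^ δ := by
  have hbd := hc.eventually (gt_mem_nhds (show c < |c| + 1 by linarith [le_abs_self c]))
  obtain ⟨b, hb, hsub⟩ := mem_nhdsGT_iff_exists_Ioo_subset.1 hbd
  have hb0 : (0 : ℝ) < b := hb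
  have hn : ∀ m, 0 ≤ charArith S m / m := fun m => div_nonneg (charArith_nonneg S m) (by positivity)
  have hlarge : ∀ x, 1 < x → 1 / log x < b →
      sumUpTo (fun m => charArith S m / m) x ≤ exp 1 * (|c| + 1) * (1 + log x) ^ δ := by
    intro x hx hxb
    have hx0 : 0 < x := by linarith
    have hl : 0 < log x := log_pos hx
    set ε := 1 / log x with hε
    have hε0 : 0 < ε := by positivity
    have hL : LSeries' S (1 + ε) * ε ^ δ < |c| + 1 := hsub ⟨hε0, hxb⟩
    have h1 : sumUpTo (fun m => charArith S m / m) x ≤ exp 1 * LSeries' S (1 + ε) := by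
      rw [LSeries'_eq S (by positivity)]
      refine le_trans ?_ (mul_le_mul_of_nonneg_left
        ((summable_charArith_mul_rpow S (show 1 < 1 + ε by linarith)).sum_le_tsum
        (Finset.Ioc 0 ⌊x⌋₊) fun n _ => mul_nonneg (charArith_nonneg S n) (by positivity))
        (exp_pos 1).le)
      rw [Finset.mul_sum]
      refine Finset.sum_le_sum fun m hm => ?_
      obtain ⟨hm0, hmx⟩ := (mem_Ioc_floor_iff hx0.le).1 hm
      have hm0' : (0 : ℝ) < m := by exact_mod_cast hm0
      have h2 : exp (-1) ≤ (m : ℝ) ^ (-ε) := by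
        rw [rpow_def_of_pos hm0', exp_le_exp]
        have : log m ≤ log x := log_le_log hm0' hmx
        have h3 : log m * ε ≤ 1 := by
          rw [hε, mul_one_div]; exact (div_le_one hl).2 this
        linarith
      have h3 : (m : ℝ) ^ (-(1 + ε)) = (m : ℝ)⁻¹ * (m : ℝ) ^ (-ε) := by
        rw [neg_add, rpow_add hm0', rpow_neg_one]
      rw [h3]
      calc charArith S m / m = exp 1 * (charArith S m * ((m : ℝ)⁻¹ * exp (-1))) := by
            rw [exp_neg]
            field_simp
        _ ≤ _ := by
          have := charArith_nonneg S m
          gcongr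
    have h2 : LSeries' S (1 + ε) ≤ (|c| + 1) * log x ^ δ := by
      have : ε ^ δ = (log x ^ δ)⁻¹ := by rw [hε, one_div, inv_rpow hl.le]
      rw [this, ← div_eq_mul_inv, div_lt_iff₀ (by positivity)] at hL
      exact hL.le
    calc _ ≤ exp 1 * ((|c| + 1) * log x ^ δ) := h1.trans (by gcongr)
      _ ≤ exp 1 * ((|c| + 1) * (1 + log x) ^ δ) := by gcongr; linarith
      _ = _ := by ring
  set X := exp (2 / b) with hX
  refine ⟨exp 1 * (|c| + 1) + sumUpTo (fun m => charArith S m / m) X, fun x hx => ?_⟩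
  have hl := log_nonneg hx
  have hX0 := sumUpTo_nonneg hn X
  have hone : 1 ≤ (1 + log x) ^ δ := one_le_rpow (by linarith) hδ0.le
  rw [add_mul]
  rcases lt_or_ge X x with h | h
  · have hX1 : 1 < X := by rw [hX]; exact one_lt_exp_iff.2 (by positivity)
    have hlx : 2 / b < log x := by
      rw [← log_exp (2 / b)]; exact log_lt_log (exp_pos _) h
    have := hlarge x (hX1.trans h) (by
      have : 0 < 2 / b := by positivity
      rw [div_lt_iff₀ (by linarith)]
      rw [div_lt_iff₀ hb0] at hlx
      linarith)
    have h5 : 0 ≤ sumUpTo (fun m => charArith S m / m) X * (1 + log x) ^ δ := by positivity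
    linarith
  · have := sumUpTo_mono hn h
    have h5 : sumUpTo (fun m => charArith S m / m) X ≤
        sumUpTo (fun m => charArith S m / m) X * (1 + log x) ^ δ := le_mul_of_one_le_right hX0 hone
    have : 0 ≤ exp 1 * (|c| + 1) * (1 + log x) ^ δ := by positivity
    linarith

open MeasureTheory in
lemma integrableOn_max_mul_exp {ε : ℝ} (hε : 0 < ε) (m : ℕ) :
    IntegrableOn (fun u => max 0 (1 / (m : ℝ) - exp (-u)) * exp (-ε * u)) (Set.Ioi 0) := by
  refine ((exp_neg_integrableOn_Ioi 0 hε).const_mul (1 / (m : ℝ))).mono'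
    (by fun_prop) (Eventually.of_forall fun u => ?_)
  rw [norm_mul, norm_of_nonneg (le_max_left _ _), norm_of_nonneg (exp_pos _).le]
  gcongr
  exact max_le (by positivity) (by linarith [exp_pos (-u)])

open MeasureTheory in
lemma integral_max_mul_exp {ε : ℝ} (hε : 0 < ε) {m : ℕ} (hm : 0 < m) :
    ∫ u in Set.Ioi 0, max 0 (1 / (m : ℝ) - exp (-u)) * exp (-ε * u) =
      (m : ℝ) ^ (-(1 + ε)) / (ε * (1 + ε)) := by
  have hm0 : (0 : ℝ) < m := by exact_mod_cast hm
  have hlm : 0 ≤ log m := log_natCast_nonneg m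
  have hexp : exp (-log m) = 1 / m := by rw [exp_neg, exp_log hm0, one_div]
  rw [setIntegral_eq_of_subset_of_forall_sdiff_eq_zero measurableSet_Ioi
    (Set.Ioi_subset_Ioi hlm)]
  · have h1 : ∀ u ∈ Set.Ioi (log m), max 0 (1 / (m : ℝ) - exp (-u)) * exp (-ε * u) =
        1 / m * exp (-ε * u) - exp (-(1 + ε) * u) := by
      intro u hu
      have : exp (-u) ≤ 1 / m := by rw [← hexp]; exact exp_le_exp.2 (neg_le_neg (le_of_lt hu))
      rw [max_eq_right (by linarith), sub_mul, ← exp_add]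
      ring_nf
    rw [setIntegral_congr_fun measurableSet_Ioi h1, integral_sub
      ((exp_neg_integrableOn_Ioi _ hε).const_mul _) (exp_neg_integrableOn_Ioi _ (by linarith)),
      integral_const_mul, integral_exp_mul_Ioi (by linarith), integral_exp_mul_Ioi (by linarith),
      rpow_def_of_pos hm0, ← hexp]
    have h2 : exp (-ε * log m) = exp (log m) * exp (log m * -(1 + ε)) := by
      rw [← exp_add]; ring_nf
    have h3 : exp (-(1 + ε) * log m) = exp (log m * -(1 + ε)) := by ring_nf
    rw [h2, h3, exp_neg]
    field_simp
    ring
  · intro u hu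
    have : u ≤ log m := not_lt.1 fun h => hu.2 h
    have : 1 / m ≤ exp (-u) := by rw [← hexp]; exact exp_le_exp.2 (neg_le_neg this)
    rw [max_eq_left (by linarith), zero_mul]

lemma hasSum_meanSum (f : ℕ → ℝ) (hf0 : f 0 = 0) (u : ℝ) :
    HasSum (fun m => f m * max 0 (1 / (m : ℝ) - exp (-u))) (meanSum f u) := by
  obtain ⟨N, hN⟩ := exists_nat_ge (exp u)
  rw [meanSum_eq_sum_max f hN]
  refine hasSum_sum_of_ne_finset_zero fun m hm => ?_
  rcases Nat.eq_zero_or_pos m with rfl | hm0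
  · rw [hf0, zero_mul]
  · have h1 : N < m := by
      by_contra! h; exact hm (Finset.mem_Ioc.2 ⟨hm0, h⟩)
    have h2 : exp u ≤ m := hN.trans (by exact_mod_cast h1.le)
    have h3 : 1 / (m : ℝ) ≤ exp (-u) := by
      rw [exp_neg, one_div]; exact inv_anti₀ (exp_pos u) h2
    rw [max_eq_left (by linarith), mul_zero]

open MeasureTheory in
/-- The Laplace transform of `meanSum f` is given by the Dirichlet series of `f`. -/
lemma integral_meanSum_mul_exp {f : ℕ → ℝ} (hf : ∀ m, 0 ≤ f m) (hf0 : f 0 = 0) {ε : ℝ}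
    (hε : 0 < ε) (hs : Summable fun m => f m * (m : ℝ) ^ (-(1 + ε))) :
    ∫ u in Set.Ioi 0, meanSum f u * exp (-ε * u) =
      (∑' m, f m * (m : ℝ) ^ (-(1 + ε))) / (ε * (1 + ε)) := by
  have hintegral : ∀ m, ∫ u in Set.Ioi 0, f m * (max 0 (1 / (m : ℝ) - exp (-u)) * exp (-ε * u)) =
      f m * (m : ℝ) ^ (-(1 + ε)) / (ε * (1 + ε)) := by
    intro m
    rw [integral_const_mul]
    rcases Nat.eq_zero_or_pos m with rfl | hm
    · simp [hf0]
    · rw [integral_max_mul_exp hε hm, mul_div_assoc]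
  have h := hasSum_integral_of_summable_integral_norm
    (F := fun m u => f m * (max 0 (1 / (m : ℝ) - exp (-u)) * exp (-ε * u)))
    (μ := volume.restrict (Set.Ioi 0)) (fun m => (integrableOn_max_mul_exp hε m).const_mul _) (by
      have : ∀ m u, ‖f m * (max 0 (1 / (m : ℝ) - exp (-u)) * exp (-ε * u))‖ =
          f m * (max 0 (1 / (m : ℝ) - exp (-u)) * exp (-ε * u)) := fun m u =>
        norm_of_nonneg (mul_nonneg (hf m) (mul_nonneg (le_max_left _ _) (exp_pos _).le))
      simp only [this, hintegral]
      exact hs.div_const _)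
  simp only [hintegral] at h
  have h2 : ∀ u, ∑' m, f m * (max 0 (1 / (m : ℝ) - exp (-u)) * exp (-ε * u)) =
      meanSum f u * exp (-ε * u) := by
    intro u
    simp only [← mul_assoc]
    exact ((hasSum_meanSum f hf0 u).mul_right _).tsum_eq
  simp only [h2] at h
  rw [← h.tsum_eq, tsum_div_const]

open MeasureTheory in
/-- An Abelian theorem for Laplace transforms of functions `o(u ^ (δ - 1))`. -/
lemma tendsto_rpow_mul_laplace {δ : ℝ} (hδ : 0 < δ) {r : ℝ → ℝ} (hr : Measurable r)
    (hloc : ∀ U, IntegrableOn r (Set.Ioc 0 U))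
    (hlim : Tendsto (fun u => u ^ (1 - δ) * r u) atTop (nhds 0)) :
    (∀ ε, 0 < ε → IntegrableOn (fun u => r u * exp (-ε * u)) (Set.Ioi 0)) ∧
    Tendsto (fun ε => ε ^ δ * ∫ u in Set.Ioi 0, r u * exp (-ε * u))
      (nhdsWithin 0 (Set.Ioi 0)) (nhds 0) := by
  have hG := Gamma_pos_of_pos hδ
  have hkey : ∀ η, 0 < η → ∃ R, ∀ ε, 0 < ε →
      IntegrableOn (fun u => r u * exp (-ε * u)) (Set.Ioi 0) ∧
      |∫ u in Set.Ioi 0, r u * exp (-ε * u)| ≤ R + η * ((1 / ε) ^ δ * Gamma δ) := by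
    intro η hη
    obtain ⟨U, hU⟩ := eventually_atTop.1 (((tendsto_order.1 hlim.abs).2 η (by simpa using hη)))
    set b : ℝ → ℝ := (Set.Ioc 0 U).indicator fun u => |r u| with hb
    have hbint : IntegrableOn b (Set.Ioi 0) :=
      ((integrable_indicator_iff measurableSet_Ioc).2 (hloc U).abs).integrableOn
    have hpos : ∀ u, 0 < u → |r u| ≤ b u + η * u ^ (δ - 1) := by
      intro u hu
      have h1 : 0 ≤ η * u ^ (δ - 1) := by positivity
      by_cases h : u ≤ U
      · rw [hb, Set.indicator_of_mem (Set.mem_Ioc.2 ⟨hu, h⟩)]; linarith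
      · rw [hb, Set.indicator_of_notMem fun h' => h h'.2, zero_add]
        have h2 := hU u (not_le.1 h).le
        rw [abs_mul, abs_of_pos (rpow_pos_of_pos hu _)] at h2
        have h3 : u ^ (δ - 1) * u ^ (1 - δ) = 1 := by
          rw [← rpow_add hu]; simp
        calc |r u| = u ^ (δ - 1) * (u ^ (1 - δ) * |r u|) := by rw [← mul_assoc, h3, one_mul]
          _ ≤ u ^ (δ - 1) * η := by gcongr
          _ = _ := mul_comm _ _
    refine ⟨∫ u in Set.Ioi 0, b u, fun ε hε => ?_⟩
    have hpint : IntegrableOn (fun u => u ^ (δ - 1) * exp (-(ε * u))) (Set.Ioi 0) := by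
      have := integrableOn_rpow_mul_exp_neg_mul_rpow (s := δ - 1) (p := 1) (b := ε)
        (by linarith) one_pos hε
      simpa only [rpow_one, neg_mul] using this
    have hmaj : ∀ u ∈ Set.Ioi (0 : ℝ), ‖r u * exp (-ε * u)‖ ≤
        b u + η * (u ^ (δ - 1) * exp (-(ε * u))) := by
      intro u (hu : 0 < u)
      have he : exp (-ε * u) ≤ 1 := exp_le_one_iff.2 (by nlinarith)
      have hb0 : 0 ≤ b u := Set.indicator_nonneg (fun _ _ => abs_nonneg _) u
      rw [norm_mul, norm_of_nonneg (exp_pos _).le, norm_eq_abs]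
      calc |r u| * exp (-ε * u) ≤ (b u + η * u ^ (δ - 1)) * exp (-ε * u) := by
            gcongr; exact hpos u hu
        _ = b u * exp (-ε * u) + η * (u ^ (δ - 1) * exp (-(ε * u))) := by
            rw [neg_mul]; ring
        _ ≤ b u * 1 + η * (u ^ (δ - 1) * exp (-(ε * u))) := by gcongr
        _ = _ := by rw [mul_one]
    have hmajint := hbint.add (hpint.const_mul η)
    have hae := (ae_restrict_iff' (μ := volume) measurableSet_Ioi).2 (Eventually.of_forall hmaj)
    refine ⟨hmajint.mono' (by fun_prop) hae, ?_⟩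
    rw [← norm_eq_abs]
    refine (norm_integral_le_of_norm_le hmajint hae).trans (le_of_eq ?_)
    rw [integral_add' hbint (hpint.const_mul η), integral_const_mul,
      integral_rpow_mul_exp_neg_mul_Ioi hδ hε]
  refine ⟨fun ε hε => ((hkey 1 one_pos).choose_spec ε hε).1, ?_⟩
  rw [Metric.tendsto_nhds]
  intro η hη
  obtain ⟨R, hR⟩ := hkey (η / (2 * Gamma δ)) (by positivity)
  have h1 : Tendsto (fun ε : ℝ => ε ^ δ * R) (nhdsWithin 0 (Set.Ioi 0)) (nhds 0) := by
    have : ContinuousAt (fun ε : ℝ => ε ^ δ * R) 0 := by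
      refine ContinuousAt.mul (continuousAt_rpow_const _ _ (Or.inr hδ.le)) continuousAt_const
    have := this.tendsto
    rw [zero_rpow hδ.ne', zero_mul] at this
    exact this.mono_left nhdsWithin_le_nhds
  filter_upwards [(tendsto_order.1 h1).2 (η / 2) (by positivity), self_mem_nhdsWithin]
    with ε h2 (hε : 0 < ε)
  rw [dist_zero_right, norm_mul, norm_of_nonneg (rpow_nonneg hε.le _), norm_eq_abs]
  calc _ ≤ ε ^ δ * (R + η / (2 * Gamma δ) * ((1 / ε) ^ δ * Gamma δ)) := by
        gcongr; exact (hR ε hε).2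
    _ = ε ^ δ * R + η / 2 := by
        rw [one_div, inv_rpow hε.le]
        field_simp
    _ < η := by linarith

open MeasureTheory in
/-- Matching a two-term expansion of the mean of `f` with that of its Dirichlet series at `1`. -/
theorem coeff_eq_of_laplace {f : ℕ → ℝ} (hf : ∀ m, 0 ≤ f m) (hf0 : f 0 = 0)
    (hs : ∀ ε : ℝ, 0 < ε → Summable fun m => f m * (m : ℝ) ^ (-(1 + ε))) {δ A K c γ : ℝ}
    (hδ : 0 < δ)
    (hM : Tendsto (fun u => u * (meanSum f u * u ^ (-δ) - A)) atTop (nhds (-K)))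
    (hD : Tendsto (fun ε : ℝ => ((∑' m, f m * (m : ℝ) ^ (-(1 + ε))) * ε ^ δ - c) / ε)
      (nhdsWithin 0 (Set.Ioi 0)) (nhds (c * γ))) :
    c = A * δ * Gamma δ ∧ K = (1 - γ) * (A * δ) := by
  have hpow : ∀ a : ℝ, -1 < a → ∀ ε, 0 < ε →
      IntegrableOn (fun u => u ^ a * exp (-ε * u)) (Set.Ioi 0) := by
    intro a ha ε hε
    have := integrableOn_rpow_mul_exp_neg_mul_rpow (s := a) (p := 1) (b := ε)
      ha one_pos hε
    simpa only [rpow_one] using this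
  have hloc : ∀ a : ℝ, -1 < a → ∀ U, IntegrableOn (fun u : ℝ => u ^ a) (Set.Ioc 0 U) := by
    intro a ha U
    rcases le_or_gt 0 U with h | h
    · exact (intervalIntegrable_iff_integrableOn_Ioc_of_le h).1
        (intervalIntegral.intervalIntegrable_rpow' ha)
    · rw [Set.Ioc_eq_empty (by linarith)]; exact integrableOn_empty
  set r : ℝ → ℝ := fun u => meanSum f u - A * u ^ δ + K * u ^ (δ - 1) with hr
  obtain ⟨hri, hrl⟩ := tendsto_rpow_mul_laplace hδ (r := r)
    (by have := (continuous_meanSum f).measurable; fun_prop)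
    (fun U => by
      refine ((Continuous.integrableOn_Ioc (continuous_meanSum f)).sub
        ((hloc δ (by linarith) U).const_mul A)).add ((hloc (δ - 1) (by linarith) U).const_mul K))
    (by
      have := hM.add_const K
      rw [neg_add_cancel] at this
      refine this.congr' ?_
      filter_upwards [eventually_gt_atTop 0] with u hu
      have h1 : u ^ (1 - δ) = u * u ^ (-δ) := by
        rw [sub_eq_add_neg, rpow_add hu, rpow_one]
      have h2 : u ^ (δ - 1) = u ^ δ * u⁻¹ := by
        rw [sub_eq_add_neg, rpow_add hu, rpow_neg_one]
      rw [hr, h1]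
      simp only [h2, rpow_neg hu.le]
      have := rpow_pos_of_pos hu δ
      field_simp)
  set D : ℝ → ℝ := fun ε => ∑' m, f m * (m : ℝ) ^ (-(1 + ε)) with hDdef
  have hE : ∀ ε, 0 < ε → ε ^ δ * ∫ u in Set.Ioi 0, r u * exp (-ε * u) =
      (D ε * ε ^ δ / (1 + ε) - A * Gamma (δ + 1)) / ε + K * Gamma δ := by
    intro ε hε
    have hi1 := (hpow δ (by linarith) ε hε).const_mul A
    have hi2 := (hpow (δ - 1) (by linarith) ε hε).const_mul K
    have hi0 : IntegrableOn (fun u => meanSum f u * exp (-ε * u)) (Set.Ioi 0) := by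
      refine (((hri ε hε).add hi1).sub hi2).congr_fun (fun u _ => ?_) measurableSet_Ioi
      simp only [Pi.add_apply, Pi.sub_apply, hr]
      ring
    have h1 : ∫ u in Set.Ioi 0, r u * exp (-ε * u) =
        (∫ u in Set.Ioi 0, meanSum f u * exp (-ε * u)) -
        A * (∫ u in Set.Ioi 0, u ^ δ * exp (-ε * u)) +
        K * ∫ u in Set.Ioi 0, u ^ (δ - 1) * exp (-ε * u) := by
      rw [← integral_const_mul, ← integral_const_mul, ← integral_sub' hi0 hi1,
        ← integral_add' (hi0.sub hi1) hi2]
      refine integral_congr_ae (Eventually.of_forall fun u => ?_)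
      simp only [hr, Pi.add_apply, Pi.sub_apply]
      ring
    have h2 : ∀ a : ℝ, 0 < a → ∫ u in Set.Ioi 0, u ^ (a - 1) * exp (-ε * u) =
        (1 / ε) ^ a * Gamma a := by
      intro a ha
      rw [← integral_rpow_mul_exp_neg_mul_Ioi ha hε]
      simp only [neg_mul]
    have h3 := h2 (δ + 1) (by linarith)
    rw [add_sub_cancel_right] at h3
    rw [h1, integral_meanSum_mul_exp hf hf0 hε (hs ε hε), h3, h2 δ hδ, one_div,
      inv_rpow hε.le, inv_rpow hε.le, rpow_add hε, rpow_one]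
    have := rpow_pos_of_pos hε δ
    have h4 : 1 + ε ≠ 0 := by positivity
    simp only [hDdef]
    field_simp
  have hG := Gamma_pos_of_pos hδ
  have hGs : Gamma (δ + 1) = δ * Gamma δ := Gamma_add_one hδ.ne'
  have hid : Tendsto (fun ε : ℝ => ε) (nhdsWithin 0 (Set.Ioi 0)) (nhds 0) :=
    nhdsWithin_le_nhds
  have hdiff : Tendsto (fun ε => (A * Gamma (δ + 1) * (1 + ε) - c) / ε)
      (nhdsWithin 0 (Set.Ioi 0)) (nhds (c * γ - (1 + 0) * (0 - K * Gamma δ))) := by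
    refine (hD.sub ((hid.const_add 1).mul (hrl.sub_const (K * Gamma δ)))).congr' ?_
    filter_upwards [self_mem_nhdsWithin] with ε (hε : 0 < ε)
    rw [hE ε hε]
    have h4 : 1 + ε ≠ 0 := by positivity
    simp only [hDdef]
    field_simp
    ring
  have hc : A * Gamma (δ + 1) = c := by
    have h1 := hdiff.mul hid
    have h2 : Tendsto (fun ε : ℝ => A * Gamma (δ + 1) * (1 + ε) - c)
        (nhdsWithin 0 (Set.Ioi 0)) (nhds (A * Gamma (δ + 1) * (1 + 0) - c)) :=
      ((hid.const_add 1).const_mul _).sub_const c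
    have h3 := tendsto_nhds_unique h2 (h1.congr' (by
      filter_upwards [self_mem_nhdsWithin] with ε (hε : 0 < ε)
      field_simp))
    linarith
  have hK : c = c * γ - (1 + 0) * (0 - K * Gamma δ) := by
    refine tendsto_nhds_unique (tendsto_const_nhds.congr' ?_) hdiff
    filter_upwards [self_mem_nhdsWithin] with ε (hε : 0 < ε)
    rw [hc]
    field_simp
    ring
  rw [hGs] at hc
  refine ⟨by linarith, ?_⟩
  have : K * Gamma δ = (1 - γ) * (A * δ) * Gamma δ := by
    rw [← hc] at hK; linarith
  exact mul_right_cancel₀ hG.ne' this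

/-- If a Dirichlet series tends to `ℓ` at `0` and the partial sums of its coefficients are
eventually at most `M`, then `ℓ ≤ M`. -/
lemma le_of_eventually_sum_le {b : ℕ → ℝ} (hb0 : b 0 = 0) {g : ℝ → ℝ} {ℓ M : ℝ}
    (hs : ∀ ε, 0 < ε → HasSum (fun n => b n * (n : ℝ) ^ (-ε)) (g ε))
    (hg : Tendsto g (nhdsWithin 0 (Set.Ioi 0)) (nhds ℓ))
    (hM : ∀ᶠ N in atTop, ∑ n ∈ Finset.range N, b n ≤ M) : ℓ ≤ M := by
  obtain ⟨N₁, hN₁⟩ := eventually_atTop.1 hM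
  set N₀ := N₁ + 1 with hN₀
  set B : ℕ → ℝ := fun N => ∑ n ∈ Finset.range N, b n with hB
  have hB' : ∀ N, N₀ ≤ N → B N ≤ M := fun N h => hN₁ N (by omega)
  have hle : ∀ ε : ℝ, 0 < ε → g ε ≤ ∑ n ∈ Finset.range N₀, b n * (n : ℝ) ^ (-ε) +
      (M - B N₀) * (N₀ : ℝ) ^ (-ε) := by
    intro ε hε
    have hind : ∀ N, N₀ ≤ N → ∑ n ∈ Finset.range N, b n * (n : ℝ) ^ (-ε) ≤
        ∑ n ∈ Finset.range N₀, b n * (n : ℝ) ^ (-ε) +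
          (M - B N₀) * (N₀ : ℝ) ^ (-ε) + (B N - M) * (N : ℝ) ^ (-ε) := by
      intro N hN
      induction N, hN using Nat.le_induction with
      | base => exact le_of_eq (by ring)
      | succ N hN ih =>
        have hNpos : (0 : ℝ) < N := by exact_mod_cast (by omega : 0 < N)
        have h1 : ((N + 1 : ℕ) : ℝ) ^ (-ε) ≤ (N : ℝ) ^ (-ε) := by
          refine rpow_le_rpow_of_nonpos hNpos (by push_cast; linarith) (by linarith)
        have h2 : B (N + 1) = B N + b N := Finset.sum_range_succ _ _
        have h3 := hB' (N + 1) (by omega)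
        rw [Finset.sum_range_succ]
        have h4 : (B (N + 1) - M) * (N : ℝ) ^ (-ε) ≤
            (B (N + 1) - M) * ((N + 1 : ℕ) : ℝ) ^ (-ε) :=
          mul_le_mul_of_nonpos_left h1 (by linarith)
        have h5 : (B (N + 1) - M) * (N : ℝ) ^ (-ε) =
          (B N - M) * (N : ℝ) ^ (-ε) + b N * (N : ℝ) ^ (-ε) := by rw [h2]; ring
        linarith
    refine le_of_tendsto (hs ε hε).tendsto_sum_nat ?_
    filter_upwards [eventually_ge_atTop N₀] with N hN
    have h1 := hind N hN
    have h2 : (B N - M) * (N : ℝ) ^ (-ε) ≤ 0 :=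
      mul_nonpos_of_nonpos_of_nonneg (by linarith [hB' N hN]) (by positivity)
    linarith
  have hpow : ∀ n : ℕ, n ≠ 0 → Tendsto (fun ε : ℝ => (n : ℝ) ^ (-ε))
      (nhdsWithin 0 (Set.Ioi 0)) (nhds 1) := by
    intro n hn
    have hn' : (n : ℝ) ≠ 0 := by exact_mod_cast hn
    have : ContinuousAt (fun ε : ℝ => (n : ℝ) ^ (-ε)) 0 :=
      (continuousAt_const_rpow hn').comp continuousAt_neg
    have := this.tendsto
    rw [neg_zero, rpow_zero] at this
    exact this.mono_left nhdsWithin_le_nhds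
  have hlim : Tendsto (fun ε : ℝ => ∑ n ∈ Finset.range N₀, b n * (n : ℝ) ^ (-ε) +
      (M - B N₀) * (N₀ : ℝ) ^ (-ε)) (nhdsWithin 0 (Set.Ioi 0))
      (nhds (B N₀ + (M - B N₀) * 1)) := by
    refine Tendsto.add (tendsto_finsetSum _ fun n _ => ?_) ((hpow N₀ (by omega)).const_mul _)
    rcases eq_or_ne n 0 with rfl | hn
    · simp [hb0]
    · simpa using (hpow n hn).const_mul (b n)
  have := le_of_tendsto_of_tendsto hg hlim (by
    filter_upwards [self_mem_nhdsWithin] with ε hε using hle ε hε)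
  linarith

lemma summable_coeff_mul_pow {a : ℕ → ℝ} (ha : ∀ e, 0 ≤ a e) (ha1 : ∀ e, a e ≤ 1) {t : ℝ}
    (ht0 : 0 ≤ t) (ht : t < 1) : Summable fun e => a e * t ^ e :=
  Summable.of_nonneg_of_le (fun e => mul_nonneg (ha e) (by positivity))
    (fun e => mul_le_of_le_one_left (by positivity) (ha1 e)) (summable_geometric_of_lt_one ht0 ht)

lemma tsum_coeff_mul_pow_bounds {a : ℕ → ℝ} (ha : ∀ e, 0 ≤ a e) (ha1 : ∀ e, a e ≤ 1)
    (ha0 : a 0 = 1) {t : ℝ} (ht0 : 0 ≤ t) (ht : t ≤ 1 / 2) :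
    1 + a 1 * t ≤ ∑' e, a e * t ^ e ∧ ∑' e, a e * t ^ e ≤ 1 + a 1 * t + 2 * t ^ 2 := by
  have hs := summable_coeff_mul_pow ha ha1 ht0 (by linarith)
  have h1 := hs.sum_add_tsum_nat_add 2
  simp only [Finset.sum_range_succ, Finset.sum_range_zero, ha0, pow_zero, pow_one] at h1
  have h2 : 0 ≤ ∑' e, a (e + 2) * t ^ (e + 2) :=
    tsum_nonneg fun e => mul_nonneg (ha _) (by positivity)
  have h3 : ∑' e, a (e + 2) * t ^ (e + 2) ≤ ∑' e, t ^ e * t ^ 2 := by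
    refine ((summable_nat_add_iff 2).2 hs).tsum_le_tsum (fun e => ?_)
      ((summable_geometric_of_lt_one ht0 (by linarith)).mul_right _)
    rw [← pow_add]
    exact mul_le_of_le_one_left (by positivity) (ha1 _)
  rw [tsum_mul_right, tsum_geometric_of_lt_one ht0 (by linarith)] at h3
  have h4 : (1 - t)⁻¹ ≤ 2 := by
    rw [inv_le_comm₀ (by linarith) two_pos]; linarith
  have h5 : (1 - t)⁻¹ * t ^ 2 ≤ 2 * t ^ 2 := by gcongr
  constructor <;> linarith

/-- The logarithm of a local factor of `L_S ζ^{-δ}`. -/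
noncomputable def localLog (a : ℕ → ℝ) (δ t : ℝ) : ℝ :=
  log (∑' e, a e * t ^ e) + δ * log (1 - t)

lemma abs_localLog_sub_le {a : ℕ → ℝ} (ha : ∀ e, 0 ≤ a e) (ha1 : ∀ e, a e ≤ 1)
    (ha0 : a 0 = 1) {δ t : ℝ} (hδ0 : 0 ≤ δ) (hδ1 : δ ≤ 1) (ht0 : 0 ≤ t) (ht : t ≤ 1 / 2) :
    |localLog a δ t - (a 1 - δ) * t| ≤ 8 * t ^ 2 := by
  obtain ⟨h1, h2⟩ := tsum_coeff_mul_pow_bounds ha ha1 ha0 ht0 ht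
  set F := ∑' e, a e * t ^ e with hF
  have ha1t : 0 ≤ a 1 * t := mul_nonneg (ha 1) ht0
  have ha1t' : a 1 * t ≤ t := mul_le_of_le_one_left ht0 (ha1 1)
  have hF0 : 0 < F := by linarith
  have h3 := log_le_sub_one_of_pos hF0
  have h4 := one_sub_inv_le_log_of_pos hF0
  have h5 : (F - 1) - (F - 1) ^ 2 ≤ 1 - F⁻¹ := by
    have : 1 - F⁻¹ - ((F - 1) - (F - 1) ^ 2) = (F - 1) ^ 3 / F := by field_simp; ring
    have h6 : 0 ≤ (F - 1) ^ 3 / F := div_nonneg (pow_nonneg (by linarith) 3) hF0.le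
    linarith
  have h6 : (F - 1) ^ 2 ≤ (2 * t) ^ 2 := by
    refine pow_le_pow_left₀ (by linarith) ?_ 2
    nlinarith
  have h1t : 0 < 1 - t := by linarith
  have h7 := log_le_sub_one_of_pos h1t
  have h8 := one_sub_inv_le_log_of_pos h1t
  have h9 : -t - 2 * t ^ 2 ≤ 1 - (1 - t)⁻¹ := by
    have : 1 - (1 - t)⁻¹ - (-t - 2 * t ^ 2) = t ^ 2 * (1 - 2 * t) / (1 - t) := by
      field_simp; ring
    have h10 : 0 ≤ t ^ 2 * (1 - 2 * t) / (1 - t) :=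
      div_nonneg (mul_nonneg (by positivity) (by linarith)) h1t.le
    linarith
  have h10 : δ * (log (1 - t) + t) ≤ 0 :=
    mul_nonpos_of_nonneg_of_nonpos hδ0 (by linarith)
  have h11 : -(2 * t ^ 2) ≤ δ * (log (1 - t) + t) := by
    have : δ * (-(2 * t ^ 2)) ≤ δ * (log (1 - t) + t) := by gcongr; linarith
    nlinarith [sq_nonneg t]
  rw [localLog, ← hF, abs_le]
  constructor <;> nlinarith

lemma continuousOn_localLog {a : ℕ → ℝ} (ha : ∀ e, 0 ≤ a e) (ha1 : ∀ e, a e ≤ 1)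
    (ha0 : a 0 = 1) (δ : ℝ) : ContinuousOn (localLog a δ) (Set.Icc 0 (1 / 2)) := by
  refine ContinuousOn.add (ContinuousOn.log (continuousOn_tsum (u := fun e => (1 / 2 : ℝ) ^ e)
    (fun e => by fun_prop) (summable_geometric_of_lt_one (by norm_num) (by norm_num))
    fun e t ht => ?_) fun t ht => ?_)
    (continuousOn_const.mul (ContinuousOn.log (by fun_prop) fun t ht => ?_))
  · rw [norm_of_nonneg (mul_nonneg (ha e) (pow_nonneg ht.1 _))]
    exact (mul_le_of_le_one_left (pow_nonneg ht.1 _) (ha1 e)).trans (pow_le_pow_left₀ ht.1 ht.2 e)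
  · have := (tsum_coeff_mul_pow_bounds ha ha1 ha0 ht.1 ht.2).1
    have := mul_nonneg (ha 1) ht.1
    linarith
  · linarith [ht.2]

lemma chiS_nonneg (S : Set ℕ) (n : ℕ) : 0 ≤ chiS S n := by
  unfold chiS; split_ifs <;> norm_num

lemma chiS_le_one (S : Set ℕ) (n : ℕ) : chiS S n ≤ 1 := by
  unfold chiS; split_ifs <;> norm_num

lemma prime_rpow_neg_mem (p : Nat.Primes) {s : ℝ} (hs : 1 ≤ s) :
    ((p : ℕ) : ℝ) ^ (-s) ∈ Set.Icc (0 : ℝ) (1 / 2) := by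
  have hp : (2 : ℝ) ≤ (p : ℕ) := by exact_mod_cast p.2.two_le
  refine ⟨by positivity, ?_⟩
  calc ((p : ℕ) : ℝ) ^ (-s) ≤ ((p : ℕ) : ℝ) ^ (-1 : ℝ) :=
        rpow_le_rpow_of_exponent_le (by linarith) (by linarith)
    _ = 1 / ((p : ℕ) : ℝ) := by rw [rpow_neg_one, one_div]
    _ ≤ 1 / 2 := by gcongr

lemma hasSum_log_eulerFactor {S : Set ℕ} (hS : IsMultiplicativeSet S) {s : ℝ} (hs : 1 < s) :
    HasSum (fun p : Nat.Primes => log (∑' e, chiS S ((p : ℕ) ^ e) * (((p : ℕ) : ℝ) ^ (-s)) ^ e))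
      (log (LSeries' S s)) := by
  have hmul := hS.charArith
  have h := EulerProduct.eulerProduct_hasProd
    (f := fun n : ℕ => charArith S n * (n : ℝ) ^ (-s)) (by simp [hmul.1])
    (fun {m n} hmn => by
      rw [hmul.2 hmn]; push_cast
      rw [mul_rpow (by positivity) (by positivity)]; ring)
    (summable_charArith_mul_rpow S hs).norm (by simp)
  rw [← LSeries'_eq S (by linarith)] at h
  have h1 : (fun p : Nat.Primes => ∑' e, charArith S ((p : ℕ) ^ e) *
      (((p : ℕ) ^ e : ℕ) : ℝ) ^ (-s)) =
      fun p : Nat.Primes => ∑' e, chiS S ((p : ℕ) ^ e) * (((p : ℕ) : ℝ) ^ (-s)) ^ e := by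
    funext p
    refine tsum_congr fun e => ?_
    rw [charArith_apply (pow_ne_zero _ p.2.ne_zero)]
    push_cast
    rw [← rpow_natCast, ← rpow_natCast, ← rpow_mul (by positivity), ← rpow_mul (by positivity),
      mul_comm (e : ℝ)]
  rw [h1] at h
  have h2 := (continuousAt_log (LSeries'_pos hS.1 hs).ne').tendsto.comp h
  refine h2.congr fun A => ?_
  rw [Function.comp_apply, log_prod]
  intro p _
  have ht := prime_rpow_neg_mem p hs.le
  have := (tsum_coeff_mul_pow_bounds (a := fun e => chiS S ((p : ℕ) ^ e))
    (fun _ => chiS_nonneg _ _) (fun _ => chiS_le_one _ _) (by simp [chiS, hS.1]) ht.1 ht.2).1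
  have h3 := mul_nonneg (chiS_nonneg S ((p : ℕ) ^ 1)) ht.1
  linarith

lemma hasSum_localLog {S : Set ℕ} (hS : IsMultiplicativeSet S) (δ : ℝ) {s : ℝ} (hs : 1 < s) :
    HasSum (fun p : Nat.Primes => localLog (fun e => chiS S ((p : ℕ) ^ e)) δ
      (((p : ℕ) : ℝ) ^ (-s)))
      (log (LSeries' S s) - δ * log (LSeries' Set.univ s)) := by
  have hu : IsMultiplicativeSet Set.univ := ⟨trivial, fun _ _ _ _ _ => by simp⟩
  refine ((hasSum_log_eulerFactor hS hs).sub ((hasSum_log_eulerFactor hu hs).mul_left δ)).congr_fun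
    fun p => ?_
  have ht := prime_rpow_neg_mem p hs.le
  simp only [chiS, Set.mem_univ, if_true, one_mul]
  rw [tsum_geometric_of_lt_one ht.1 (by linarith [ht.2]), log_inv, localLog]
  ring

lemma tendsto_mul_LSeries'_univ : Tendsto (fun ε => LSeries' Set.univ (1 + ε) * ε)
    (nhdsWithin 0 (Set.Ioi 0)) (nhds 1) := by
  have hmap : Tendsto (fun ε : ℝ => 1 + ε) (nhdsWithin 0 (Set.Ioi 0))
      (nhdsWithin 1 (Set.Ioi 1)) := by
    refine tendsto_nhdsWithin_iff.2 ⟨?_, ?_⟩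
    · have : Tendsto (fun ε : ℝ => 1 + ε) (nhds 0) (nhds (1 + 0)) :=
        tendsto_id.const_add 1
      rw [add_zero] at this
      exact this.mono_left nhdsWithin_le_nhds
    · filter_upwards [self_mem_nhdsWithin] with ε (hε : 0 < ε)
      simpa using hε
  refine (tendsto_sub_mul_tsum_nat_rpow.comp hmap).congr fun ε => ?_
  simp only [Function.comp_apply, LSeries', Set.mem_univ, if_true, add_sub_cancel_left]
  rw [mul_comm]
  congr 1
  exact tsum_congr fun n => by rw [rpow_neg (by positivity), one_div]

/-- The logarithm of the factor at `n` of the product defining the Wirsing constant. -/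
noncomputable def wirsingLog (S : Set ℕ) (δ : ℝ) (n : ℕ) : ℝ :=
  if n.Prime then localLog (fun e => chiS S (n ^ e)) δ (n : ℝ)⁻¹ else 0

lemma chiS_pow_zero {S : Set ℕ} (h1 : 1 ∈ S) (n : ℕ) : chiS S (n ^ 0) = 1 := by
  rw [pow_zero, chiS, if_pos h1]

lemma wirsingProd_eq_exp {S : Set ℕ} (h1 : 1 ∈ S) (δ : ℝ) (P : ℕ) :
    wirsingProd S δ P = exp (∑ n ∈ Finset.range P, wirsingLog S δ n) := by
  rw [exp_sum, wirsingProd, Finset.prod_filter]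
  refine Finset.prod_congr rfl fun p _ => ?_
  unfold wirsingLog
  split_ifs with hp
  · have ht := prime_rpow_neg_mem ⟨p, hp⟩ le_rfl
    rw [rpow_neg_one] at ht
    change (p : ℝ)⁻¹ ∈ _ at ht
    have hb := (tsum_coeff_mul_pow_bounds (a := fun e => chiS S (p ^ e))
      (fun _ => chiS_nonneg _ _) (fun _ => chiS_le_one _ _) (chiS_pow_zero h1 p) ht.1 ht.2).1
    have h3 := mul_nonneg (chiS_nonneg S (p ^ 1)) ht.1
    rw [localLog, exp_add, exp_log (by linarith), one_div,
      rpow_def_of_pos (by linarith [ht.2]), mul_comm δ]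
    simp only [inv_pow, div_eq_mul_inv]
  · rw [exp_zero]

lemma exists_hasSum_wirsingLog {S : Set ℕ} (hS : IsMultiplicativeSet S) {δ c : ℝ} (hδ0 : 0 < δ)
    (hδ1 : δ < 1) (hc : 0 < c)
    (hL : Tendsto (fun ε => LSeries' S (1 + ε) * ε ^ δ) (nhdsWithin 0 (Set.Ioi 0)) (nhds c)) :
    ∃ g : ℝ → ℝ, (∀ ε, 0 < ε → HasSum (fun n => wirsingLog S δ n * (n : ℝ) ^ (-ε)) (g ε)) ∧
      Tendsto g (nhdsWithin 0 (Set.Ioi 0)) (nhds (log c)) := by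
  set a : Nat.Primes → ℕ → ℝ := fun p e => chiS S ((p : ℕ) ^ e) with ha
  have ha0 : ∀ p e, 0 ≤ a p e := fun p e => chiS_nonneg _ _
  have ha1 : ∀ p e, a p e ≤ 1 := fun p e => chiS_le_one _ _
  have haz : ∀ p, a p 0 = 1 := fun p => chiS_pow_zero hS.1 _
  have hp0 : ∀ p : Nat.Primes, (0 : ℝ) < ((p : ℕ) : ℝ) := fun p => by exact_mod_cast p.2.pos
  set d : ℝ → Nat.Primes → ℝ := fun ε p => localLog (a p) δ (((p : ℕ) : ℝ) ^ (-(1 + ε))) -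
    localLog (a p) δ (((p : ℕ) : ℝ) ^ (-1 : ℝ)) * ((p : ℕ) : ℝ) ^ (-ε) with hd
  have hbd : ∀ ε : ℝ, 0 < ε → ∀ p : Nat.Primes, ‖d ε p‖ ≤ 16 * ((p : ℕ) : ℝ) ^ (-2 : ℝ) := by
    intro ε hε p
    have h1p : (1 : ℝ) ≤ ((p : ℕ) : ℝ) := by exact_mod_cast p.2.one_lt.le
    have ht := prime_rpow_neg_mem p (show 1 ≤ 1 + ε by linarith)
    have ht' := prime_rpow_neg_mem p (le_refl 1)
    have hu0 : 0 ≤ ((p : ℕ) : ℝ) ^ (-ε) := by positivity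
    have hu1 : ((p : ℕ) : ℝ) ^ (-ε) ≤ 1 := rpow_le_one_of_one_le_of_nonpos h1p (by linarith)
    have e1 := abs_localLog_sub_le (ha0 p) (ha1 p) (haz p) hδ0.le hδ1.le ht.1 ht.2
    have e2 := abs_localLog_sub_le (ha0 p) (ha1 p) (haz p) hδ0.le hδ1.le ht'.1 ht'.2
    have hq : ((p : ℕ) : ℝ) ^ (-2 : ℝ) = (((p : ℕ) : ℝ) ^ (-1 : ℝ)) ^ 2 := by
      rw [← rpow_natCast, ← rpow_mul (hp0 p).le]; norm_num
    have hsplit : ((p : ℕ) : ℝ) ^ (-(1 + ε)) =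
        ((p : ℕ) : ℝ) ^ (-1 : ℝ) * ((p : ℕ) : ℝ) ^ (-ε) := by
      rw [← rpow_add (hp0 p)]; ring_nf
    rw [hq]
    simp only [hd, norm_eq_abs]
    rw [hsplit] at e1 ⊢
    set t := ((p : ℕ) : ℝ) ^ (-1 : ℝ)
    set u := ((p : ℕ) : ℝ) ^ (-ε)
    have e3 : |localLog (a p) δ t * u - (a p 1 - δ) * (t * u)| ≤ 8 * t ^ 2 := by
      have : localLog (a p) δ t * u - (a p 1 - δ) * (t * u) =
        (localLog (a p) δ t - (a p 1 - δ) * t) * u := by ring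
      rw [this, abs_mul, abs_of_nonneg hu0]
      calc _ ≤ 8 * t ^ 2 * 1 := by gcongr
        _ = _ := mul_one _
    have e4 : (t * u) ^ 2 ≤ t ^ 2 := by
      rw [mul_pow]
      exact mul_le_of_le_one_right (by positivity) (pow_le_one₀ hu0 hu1)
    rw [abs_le] at *
    constructor <;> linarith [e1.1, e1.2, e3.1, e3.2]
  have hsum2 : Summable fun p : Nat.Primes => 16 * ((p : ℕ) : ℝ) ^ (-2 : ℝ) :=
    ((Real.summable_nat_rpow.2 (by norm_num : (-2 : ℝ) < -1)).comp_injective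
      Subtype.val_injective).mul_left 16
  have hdlim : Tendsto (fun ε => ∑' p, d ε p) (nhdsWithin 0 (Set.Ioi 0)) (nhds 0) := by
    have h := tendsto_tsum_of_dominated_convergence (𝓕 := nhdsWithin (0 : ℝ) (Set.Ioi 0))
      (f := d) (g := fun _ => 0) hsum2 (fun p => ?_) (by
        filter_upwards [self_mem_nhdsWithin] with ε hε using hbd ε hε)
    · simpa using h
    · have hcont : ∀ x : ℝ, ContinuousAt (fun y : ℝ => ((p : ℕ) : ℝ) ^ y) x :=
        fun x => continuousAt_const_rpow (hp0 p).ne'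
      have h1 : Tendsto (fun ε : ℝ => ((p : ℕ) : ℝ) ^ (-(1 + ε))) (nhdsWithin 0 (Set.Ioi 0))
          (nhdsWithin (((p : ℕ) : ℝ) ^ (-1 : ℝ)) (Set.Icc 0 (1 / 2))) := by
        refine tendsto_nhdsWithin_iff.2 ⟨?_, ?_⟩
        · have : Tendsto (fun ε : ℝ => -(1 + ε)) (nhds 0) (nhds (-(1 + 0))) :=
            (tendsto_id.const_add 1).neg
          rw [add_zero] at this
          exact ((hcont (-1)).tendsto.comp this).mono_left nhdsWithin_le_nhds
        · filter_upwards [self_mem_nhdsWithin] with ε (hε : 0 < ε)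
          exact prime_rpow_neg_mem p (by linarith)
      have h2 : Tendsto (fun ε : ℝ => ((p : ℕ) : ℝ) ^ (-ε)) (nhdsWithin 0 (Set.Ioi 0))
          (nhds 1) := by
        have : Tendsto (fun ε : ℝ => -ε) (nhds 0) (nhds (-0)) := tendsto_id.neg
        have := (hcont (-0)).tendsto.comp this
        rw [neg_zero, rpow_zero] at this
        exact this.mono_left nhdsWithin_le_nhds
      have h3 := (continuousOn_localLog (ha0 p) (ha1 p) (haz p) δ _
        (prime_rpow_neg_mem p le_rfl)).tendsto.comp h1
      have h4 := h3.sub (h2.const_mul (localLog (a p) δ (((p : ℕ) : ℝ) ^ (-1 : ℝ))))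
      rw [mul_one, sub_self] at h4
      exact h4
  refine ⟨fun ε => log (LSeries' S (1 + ε)) - δ * log (LSeries' Set.univ (1 + ε)) - ∑' p, d ε p,
    fun ε hε => ?_, ?_⟩
  · have h1 := hasSum_localLog hS δ (show 1 < 1 + ε by linarith)
    have h2 := h1.sub (hsum2.of_norm_bounded (hbd ε hε)).hasSum
    have h3 : HasSum ((fun n : ℕ => wirsingLog S δ n * (n : ℝ) ^ (-ε)) ∘
        (Subtype.val : {n : ℕ // n ∈ {p : ℕ | p.Prime}} → ℕ))
        (log (LSeries' S (1 + ε)) - δ * log (LSeries' Set.univ (1 + ε)) - ∑' p, d ε p) := by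
      refine h2.congr_fun fun p => ?_
      have hp : wirsingLog S δ (p : ℕ) = localLog (a p) δ (((p : ℕ) : ℝ) ^ (-1 : ℝ)) := by
        rw [wirsingLog, if_pos p.2, rpow_neg_one]
      change wirsingLog S δ (p : ℕ) * ((p : ℕ) : ℝ) ^ (-ε) =
        localLog (a p) δ (((p : ℕ) : ℝ) ^ (-(1 + ε))) - d ε p
      rw [hp]
      simp only [hd]
      ring
    rw [hasSum_subtype_iff_indicator] at h3
    refine h3.congr_fun fun n => ?_
    by_cases hn : n.Prime
    · rw [Set.indicator_of_mem (by exact hn)]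
    · rw [Set.indicator_of_notMem (by exact hn), wirsingLog, if_neg hn, zero_mul]
  · have h1 := (continuousAt_log hc.ne').tendsto.comp hL
    have h2 := ((continuousAt_log one_ne_zero).tendsto.comp tendsto_mul_LSeries'_univ).const_mul δ
    have h3 := (h1.sub h2).sub hdlim
    rw [log_one, mul_zero, sub_zero, sub_zero] at h3
    refine h3.congr' ?_
    filter_upwards [self_mem_nhdsWithin] with ε (hε : 0 < ε)
    have hS0 := LSeries'_pos hS.1 (show 1 < 1 + ε by linarith)
    have hu0 := LSeries'_pos (Set.mem_univ 1) (show 1 < 1 + ε by linarith)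
    simp only [Function.comp_apply]
    rw [log_mul hS0.ne' (by positivity), log_mul hu0.ne' hε.ne', log_rpow hε]
    ring

/-- The residue-type constant of `L_S` at `1` is the limit of the Euler products defining the
Wirsing constant. -/
theorem eq_of_tendsto_wirsingProd {S : Set ℕ} (hS : IsMultiplicativeSet S) {δ c W : ℝ}
    (hδ0 : 0 < δ) (hδ1 : δ < 1) (hc : 0 < c)
    (hL : Tendsto (fun ε => LSeries' S (1 + ε) * ε ^ δ) (nhdsWithin 0 (Set.Ioi 0)) (nhds c))
    (hW : Tendsto (wirsingProd S δ) atTop (nhds W)) : W = c := by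
  obtain ⟨g, hg, hgl⟩ := exists_hasSum_wirsingLog hS hδ0 hδ1 hc hL
  have h0 : wirsingLog S δ 0 = 0 := if_neg Nat.not_prime_zero
  have hexp : ∀ P, ∑ n ∈ Finset.range P, wirsingLog S δ n = log (wirsingProd S δ P) := by
    intro P; rw [wirsingProd_eq_exp hS.1, log_exp]
  have hpos : ∀ P, 0 < wirsingProd S δ P := by
    intro P; rw [wirsingProd_eq_exp hS.1]; exact exp_pos _
  refine le_antisymm (le_of_forall_lt fun w hw => ?_)
    (le_of_forall_gt_imp_ge_of_dense fun w hw => ?_)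
  · rcases le_or_gt w 0 with h | h
    · linarith
    obtain ⟨v, hwv, hv⟩ := exists_between hw
    have hv0 : 0 < v := h.trans hwv
    have := le_of_eventually_sum_le (b := fun n => -wirsingLog S δ n) (ℓ := -log c) (M := -log v)
      (g := fun ε => -g ε) (by simp [h0]) (fun ε hε => by simpa using (hg ε hε).neg) hgl.neg (by
        filter_upwards [hW.eventually (lt_mem_nhds hv)] with P hP
        rw [Finset.sum_neg_distrib, hexp]
        exact neg_le_neg (log_le_log hv0 hP.le))
    have := (log_le_log_iff hv0 hc).1 (by linarith)
    linarith
  · have hW0 : 0 ≤ W := ge_of_tendsto' hW fun P => (hpos P).le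
    have := le_of_eventually_sum_le (M := log w) h0 hg hgl (by
        filter_upwards [hW.eventually (gt_mem_nhds hw)] with P hP
        rw [hexp]
        exact log_le_log (hpos P) hP.le)
    exact (log_le_log_iff hc (by linarith)).1 this

lemma integral_log_rpow_eq (a : ℝ) {x : ℝ} (hx : 2 ≤ x) :
    ∫ t in (2 : ℝ)..x, log t ^ a =
      x * log x ^ a - 2 * log 2 ^ a - a * ∫ t in (2 : ℝ)..x, log t ^ (a - 1) := by
  have hi1 := intervalIntegrable_log_rpow a hx
  have hi2 := (intervalIntegrable_log_rpow (a - 1) hx).const_mul a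
  have h := intervalIntegral.integral_eq_sub_of_hasDerivAt
    (f := fun t => t * log t ^ a) (f' := fun t => log t ^ a + a * log t ^ (a - 1)) (a := 2) (b := x)
    (fun t ht => by
      rw [Set.uIcc_of_le hx] at ht
      have ht0 : 0 < t := by linarith [ht.1]
      have hl : 0 < log t := log_pos (by linarith [ht.1])
      refine ((hasDerivAt_id t).mul ((hasDerivAt_log ht0.ne').rpow_const
        (p := a) (Or.inl hl.ne'))).congr_deriv ?_
      simp only [id_eq]
      field_simp) (hi1.add hi2)
  rw [intervalIntegral.integral_add hi1 hi2, intervalIntegral.integral_const_mul] at h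
  linarith

lemma tendsto_log_rpow_div_atTop (r : ℝ) : Tendsto (fun x => log x ^ r / x) atTop (nhds 0) := by
  simpa using (isLittleO_log_rpow_rpow_atTop r one_pos).tendsto_div_nhds_zero

/-- The second-order expansion of `∫₂ˣ (log t) ^ (δ - 1) dt`. -/
lemma tendsto_integral_log_rpow {δ : ℝ} (hδ1 : δ < 1) :
    Tendsto (fun x => log x * ((∫ t in (2 : ℝ)..x, log t ^ (δ - 1)) / (x * log x ^ (δ - 1)) - 1))
      atTop (nhds (1 - δ)) := by
  obtain ⟨C, hC, hle⟩ := exists_integral_log_rpow_neg_le (a := 3 - δ) (by linarith)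
  set J := fun x => ∫ t in (2 : ℝ)..x, log t ^ (δ - 3) with hJ
  have hJ0 : ∀ x, 2 ≤ x → 0 ≤ J x := fun x hx =>
    intervalIntegral.integral_nonneg hx fun t ht =>
      rpow_nonneg (log_nonneg (by linarith [ht.1])) _
  have h1 := tendsto_log_rpow_div_atTop (2 - δ)
  have h2 : Tendsto (fun x => J x * (log x ^ (2 - δ) / x)) atTop (nhds 0) := by
    refine squeeze_zero' (g := fun x => C * (log x)⁻¹) ?_ ?_ (by
      simpa using tendsto_log_atTop.inv_tendsto_atTop.const_mul C)
    · filter_upwards [eventually_ge_atTop 2] with x hx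
      exact mul_nonneg (hJ0 x hx) (div_nonneg (rpow_nonneg (log_nonneg (by linarith)) _)
        (by linarith))
    · filter_upwards [eventually_ge_atTop 2] with x hx
      have hl : 0 < log x := log_pos (by linarith)
      have hx0 : 0 < x := by linarith
      have h3 := hle x hx
      rw [neg_sub] at h3
      have h4 : log x ^ (δ - 3) * log x ^ (2 - δ) = (log x)⁻¹ := by
        rw [← rpow_add hl, ← rpow_neg_one]; ring_nf
      calc J x * (log x ^ (2 - δ) / x)
          ≤ C * (x * log x ^ (δ - 3)) * (log x ^ (2 - δ) / x) := by gcongr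
        _ = C * (log x ^ (δ - 3) * log x ^ (2 - δ)) := by field_simp
        _ = _ := by rw [h4]
  have h3 := ((h1.const_mul (-(2 * log 2 ^ (δ - 1)) - (1 - δ) * (2 * log 2 ^ (δ - 2)))).add
    (h2.const_mul ((1 - δ) * (2 - δ)))).const_add (1 - δ)
  rw [mul_zero, mul_zero, add_zero, add_zero] at h3
  refine h3.congr' ?_
  filter_upwards [eventually_ge_atTop 2] with x hx
  have hl : 0 < log x := log_pos (by linarith)
  have hx0 : 0 < x := by linarith
  have e1 := integral_log_rpow_eq (δ - 1) hx
  have e2 := integral_log_rpow_eq (δ - 2) hx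
  have e3 : δ - 1 - 1 = δ - 2 := by ring
  have e4 : δ - 2 - 1 = δ - 3 := by ring
  rw [e3, e2, e4] at e1
  have e5 : log x ^ (δ - 2) = log x ^ (δ - 1) / log x := by
    rw [← e3, rpow_sub_one hl.ne']
  have e6 : log x ^ (2 - δ) = log x / log x ^ (δ - 1) := by
    rw [show 2 - δ = 1 - (δ - 1) by ring, rpow_sub hl, rpow_one]
  rw [e1, e5, e6]
  have hp := rpow_pos_of_pos hl (δ - 1)
  simp only [hJ]
  field_simp
  ring

/-- The second-order expansion of the counting function of a multiplicative set. -/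
theorem tendsto_setCount {S : Set ℕ} {δ ρ γS C₀ : ℝ} (hδ0 : 0 < δ) (hδ1 : δ < 1)
    (hρ : 0 < ρ) (hS : IsMultiplicativeSet S) (hB : ConditionB S δ ρ)
    (hEK : IsEulerKronecker S δ γS)
    (hC₀ : Tendsto (wirsingProd S δ) atTop (nhds (Gamma δ * C₀))) :
    0 < C₀ ∧ Tendsto (fun x => log x * ((setCount S x : ℝ) / (x * log x ^ (δ - 1)) - C₀)) atTop
      (nhds ((1 - δ) * (1 - γS) * C₀)) := by
  obtain ⟨c, hc, hlim⟩ := hEK.exists_tendsto hS.1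
  have hid : Tendsto (fun ε : ℝ => ε) (nhdsWithin 0 (Set.Ioi 0)) (nhds 0) :=
    nhdsWithin_le_nhds
  have hL : Tendsto (fun ε => LSeries' S (1 + ε) * ε ^ δ) (nhdsWithin 0 (Set.Ioi 0))
      (nhds c) := by
    have h := (hlim.mul hid).add_const c
    rw [mul_zero, zero_add] at h
    refine h.congr' ?_
    filter_upwards [self_mem_nhdsWithin] with ε (hε : 0 < ε)
    field_simp
    ring
  have hG := Gamma_pos_of_pos hδ0
  have hW := eq_of_tendsto_wirsingProd hS hδ0 hδ1 hc hL hC₀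
  obtain ⟨Cr, hg⟩ := exists_logDerivCoeff_le hδ0 hδ1 hρ hB
  obtain ⟨C₂, hT⟩ := exists_sumUpTo_div_le hδ0 hL
  obtain ⟨A, K, hA, hK⟩ := exists_second_order (charArith_nonneg S) (charArith S).map_zero
    hδ0 hδ1 hρ (fun x hx => sumUpTo_mul_log_eq hS.charArith hx) hg hT
  obtain ⟨h1, h2⟩ := coeff_eq_of_laplace (c := c) (γ := γS) (charArith_nonneg S)
    (charArith S).map_zero (fun ε hε => summable_charArith_mul_rpow S (by linarith)) hδ0 hA
    (hlim.congr' (by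
      filter_upwards [self_mem_nhdsWithin] with ε (hε : 0 < ε)
      rw [LSeries'_eq S (by linarith)]))
  have h3 : C₀ = A * δ := by
    rw [h1] at hW
    exact mul_left_cancel₀ hG.ne' (by linarith)
  have h4 : 0 < C₀ := by
    rw [← hW] at hc
    exact pos_of_mul_pos_right hc hG.le
  refine ⟨h4, ?_⟩
  have h5 := hK.comp tendsto_log_atTop
  rw [h2, ← h3, mul_comm δ A, ← h3, ← mul_assoc] at h5
  refine h5.congr' ?_
  filter_upwards [eventually_gt_atTop 1] with x hx
  have hl : 0 < log x := log_pos hx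
  have hx0 : 0 < x := by linarith
  rw [Function.comp_apply, setCount_eq_sumUpTo S hx0.le, exp_neg, exp_log hx0,
    show 1 - δ = -(δ - 1) by ring, rpow_neg hl.le]
  congr 2
  have := rpow_pos_of_pos hl (δ - 1)
  field_simp

lemma abs_one_sub_compare {γ k : ℝ} (hk : 0 < k) :
    (γ < 1 / 2 → |-(k * γ)| < |k * (1 - γ)|) ∧ (1 / 2 < γ → |k * (1 - γ)| < |-(k * γ)|) := by
  rw [abs_neg]
  have h1 : (k * (1 - γ)) ^ 2 - (k * γ) ^ 2 = k ^ 2 * (1 - 2 * γ) := by ring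
  have hk2 : 0 < k ^ 2 := by positivity
  constructor <;> intro h <;> rw [← sq_lt_sq] <;> nlinarith

/-- Let `S` be a multiplicative set satisfying Condition B with density `δ ∈ (0,1)`,
with Wirsing constant `C₀(S)` and Euler–Kronecker constant `γ_S`. If `γ_S < 1/2` then
for all sufficiently large `x` the Ramanujan approximation `C₀(S) ∫₂ˣ (log t)^{δ-1} dt`
is strictly better than the Landau approximation `C₀(S) x (log x)^{δ-1}`; if
`γ_S > 1/2` it is the other way around. -/
theorem ramanujan_vs_landau (S : Set ℕ) (δ ρ γS C₀ : ℝ) (hδ0 : 0 < δ) (hδ1 : δ < 1)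
    (hρ : 0 < ρ) (hS : IsMultiplicativeSet S) (hB : ConditionB S δ ρ)
    (hEK : IsEulerKronecker S δ γS)
    (hC₀ : Tendsto (wirsingProd S δ) atTop (nhds (Real.Gamma δ * C₀))) :
    (γS < 1 / 2 → ∀ᶠ x : ℝ in atTop,
        |(setCount S x : ℝ) - C₀ * ∫ t in (2:ℝ)..x, Real.log t ^ (δ - 1)| <
        |(setCount S x : ℝ) - C₀ * x * Real.log x ^ (δ - 1)|) ∧
    (γS > 1 / 2 → ∀ᶠ x : ℝ in atTop,
        |(setCount S x : ℝ) - C₀ * x * Real.log x ^ (δ - 1)| <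
        |(setCount S x : ℝ) - C₀ * ∫ t in (2:ℝ)..x, Real.log t ^ (δ - 1)|) := by
  obtain ⟨hpos, hLandau⟩ := tendsto_setCount hδ0 hδ1 hρ hS hB hEK hC₀
  set E₁ : ℝ → ℝ := fun x => (setCount S x : ℝ) - C₀ * ∫ t in (2:ℝ)..x, log t ^ (δ - 1) with hE₁
  set E₂ : ℝ → ℝ := fun x => (setCount S x : ℝ) - C₀ * x * log x ^ (δ - 1) with hE₂
  set w : ℝ → ℝ := fun x => log x / (x * log x ^ (δ - 1)) with hw
  have hw0 : ∀ x, 1 < x → 0 < w x := fun x hx => by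
    have := log_pos hx
    have : 0 < x := by linarith
    positivity
  have h₂ : Tendsto (fun x => |w x * E₂ x|) atTop (nhds |(1 - δ) * C₀ * (1 - γS)|) := by
    rw [show (1 - δ) * C₀ * (1 - γS) = (1 - δ) * (1 - γS) * C₀ by ring]
    refine (hLandau.congr' ?_).abs
    filter_upwards [eventually_gt_atTop 1] with x hx
    have hl := log_pos hx
    have hx0 : 0 < x := by linarith
    have := rpow_pos_of_pos hl (δ - 1)
    simp only [hw, hE₂]
    field_simp
  have h₁ : Tendsto (fun x => |w x * E₁ x|) atTop (nhds |-((1 - δ) * C₀ * γS)|) := by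
    rw [show -((1 - δ) * C₀ * γS) = (1 - δ) * (1 - γS) * C₀ - C₀ * (1 - δ) by ring]
    refine ((hLandau.sub ((tendsto_integral_log_rpow hδ1).const_mul C₀)).congr' ?_).abs
    filter_upwards [eventually_gt_atTop 1] with x hx
    have hl := log_pos hx
    have hx0 : 0 < x := by linarith
    have := rpow_pos_of_pos hl (δ - 1)
    simp only [hw, hE₁]
    field_simp
    ring
  have hcancel : ∀ x, 1 < x → ∀ a b : ℝ, |w x * a| < |w x * b| → |a| < |b| := by
    intro x hx a b h
    rw [abs_mul, abs_mul] at h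
    exact lt_of_mul_lt_mul_left h (abs_nonneg _)
  have hcmp := abs_one_sub_compare (γ := γS) (mul_pos (sub_pos.2 hδ1) hpos)
  constructor
  · intro h
    filter_upwards [h₁.eventually_lt h₂ (hcmp.1 h), eventually_gt_atTop 1] with x hx hx1
    exact hcancel x hx1 _ _ hx
  · intro h
    filter_upwards [h₂.eventually_lt h₁ (hcmp.2 h), eventually_gt_atTop 1] with x hx hx1
    exact hcancel x hx1 _ _ hx
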